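/- arXiv:0710.3877 — 5 statements merged into one kernel-verified Lean document; each statement's English description precedes it below -/
import Mathlib

section
/- Let Γ be a finite group of order n such that every nontrivial complex representation of Γ has dimension at least k, and let A, B, C be three subsets of Γ. (a) If |A|·|B|·|C| > n³/k, then there exist a ∈ A, b ∈ B and c ∈ C with ab = c; in particular this holds if each of A, B, C has size greater than n/k^{1/3}. (b) Furthermore, if η > 0 and |A|·|B|·|C| ≥ n³/(η²k), then the number of triples (a,b,c) ∈ A × B × C with ab = c is at least (1−η)·|A|·|B|·|C|/n. -/
open Module in
/-- If every nonzero eigenvalue of `T† T` has multiplicity at least `k`, then `T` is bounded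
by its Hilbert–Schmidt norm divided by `√k`. -/
theorem LinearMap.mul_norm_sq_apply_le_of_le_finrank_eigenspace {E F ι : Type*}
    [NormedAddCommGroup E] [InnerProductSpace ℂ E] [FiniteDimensional ℂ E]
    [NormedAddCommGroup F] [InnerProductSpace ℂ F] [FiniteDimensional ℂ F] [Fintype ι]
    (e : OrthonormalBasis ι ℂ E) (T : E →ₗ[ℂ] F) (k : ℕ)
    (hk : ∀ μ : ℂ, μ ≠ 0 → End.HasEigenvalue (T.adjoint ∘ₗ T) μ →
      k ≤ finrank ℂ (End.eigenspace (T.adjoint ∘ₗ T) μ)) (f : E) :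
    k * ‖T f‖ ^ 2 ≤ (∑ i, ‖T (e i)‖ ^ 2) * ‖f‖ ^ 2 := by
  classical
  set S := T.adjoint ∘ₗ T with hS
  have inner_S (x y : E) : inner ℂ x (S y) = inner ℂ (T x) (T y) := by
    simp [hS, LinearMap.adjoint_inner_right]
  have hsymm : S.IsSymmetric := fun x y => by
    rw [inner_S, ← inner_conj_symm, inner_S, inner_conj_symm]
  set b := hsymm.eigenvectorBasis rfl with hb
  set ev := hsymm.eigenvalues rfl with hev
  have hbev (i) : S (b i) = (ev i : ℂ) • b i := hsymm.apply_eigenvectorBasis rfl i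
  have norm_T_b (i) : ‖T (b i)‖ ^ 2 = ev i := by
    have h := inner_S (b i) (b i)
    rw [hbev, inner_smul_right, inner_self_eq_norm_sq_to_K, inner_self_eq_norm_sq_to_K,
      b.orthonormal.1 i] at h
    have h' : ((ev i : ℝ) : ℂ) = ((‖T (b i)‖ ^ 2 : ℝ) : ℂ) := by simpa using h
    exact_mod_cast h'.symm
  have ev_nonneg (i) : 0 ≤ ev i := by rw [← norm_T_b]; positivity
  have trace_eq : ∑ i, ‖T (e i)‖ ^ 2 = ∑ i, ev i := by
    have h1 := S.trace_eq_sum_inner e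
    have h2 := S.trace_eq_sum_inner b
    simp only [inner_S, inner_self_eq_norm_sq_to_K] at h1 h2
    have h3 : ∑ i, ‖T (e i)‖ ^ 2 = ∑ i, ‖T (b i)‖ ^ 2 := by
      have h := h1.symm.trans h2
      exact_mod_cast h
    rw [h3]
    exact Finset.sum_congr rfl fun i _ => norm_T_b i
  have mul_ev_le (i) : k * ev i ≤ ∑ j, ev j := by
    by_cases h0 : ev i = 0
    · rw [h0, mul_zero]
      exact Finset.sum_nonneg fun j _ => ev_nonneg j
    set s := Finset.univ.filter fun j => ev j = ev i with hs
    have hdim : k ≤ s.card := by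
      refine (hk (ev i) (by exact_mod_cast h0) (hsymm.hasEigenvalue_eigenvalues rfl i)).trans ?_
      refine (Submodule.finrank_mono (t := Submodule.span ℂ (s.image b : Set E)) ?_).trans
        ((finrank_span_finset_le_card _).trans Finset.card_image_le)
      intro v hv
      rw [End.mem_eigenspace_iff] at hv
      rw [← b.sum_repr' v]
      refine Submodule.sum_mem _ fun j _ => ?_
      by_cases hj : ev j = ev i
      · exact Submodule.smul_mem _ _ (Submodule.subset_span (by
          simpa [hs] using ⟨j, hj, rfl⟩))
      · have h := hsymm (b j) v
        rw [hbev, hv, inner_smul_left, inner_smul_right, Complex.conj_ofReal] at h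
        have h' : inner ℂ (b j) v = 0 := by
          by_contra hne
          exact hj (by exact_mod_cast mul_right_cancel₀ hne h)
        rw [h', zero_smul]
        exact Submodule.zero_mem _
    calc k * ev i ≤ s.card * ev i := by
          gcongr
          exact ev_nonneg i
      _ = ∑ j ∈ s, ev j := by
          rw [Finset.sum_congr rfl fun j hj => (Finset.mem_filter.1 hj).2]
          simp [hs]
      _ ≤ ∑ j, ev j :=
          Finset.sum_le_univ_sum_of_nonneg ev_nonneg
  have norm_T : ‖T f‖ ^ 2 = ∑ i, ev i * ‖inner ℂ (b i) f‖ ^ 2 := by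
    have h := inner_S f f
    rw [← b.sum_inner_mul_inner f (S f), inner_self_eq_norm_sq_to_K] at h
    have h' : ∀ i, inner ℂ f (b i) * inner ℂ (b i) (S f)
        = ((ev i * ‖inner ℂ (b i) f‖ ^ 2 : ℝ) : ℂ) := fun i => by
      rw [← hsymm, hbev, inner_smul_left, Complex.conj_ofReal, ← inner_conj_symm f (b i)]
      push_cast
      rw [← Complex.conj_mul']
      ring
    simp only [h'] at h
    exact Complex.ofReal_injective (by simpa using h.symm)
  rw [trace_eq, norm_T, ← b.sum_sq_norm_inner_right f, Finset.mul_sum, Finset.mul_sum]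
  refine Finset.sum_le_sum fun i _ => ?_
  rw [← mul_assoc]
  exact mul_le_mul_of_nonneg_right (mul_ev_le i) (by positivity)

open Module in
/-- A lower bound on the dimension of nontrivial matrix representations applies to
representations on arbitrary finite-dimensional spaces. -/
theorem Representation.le_finrank_of_ne_one {G V : Type*} [Group G] [AddCommGroup V] [Module ℂ V]
    [FiniteDimensional ℂ V] {k : ℕ}
    (hrep : ∀ (d : ℕ) (ρ : G →* Matrix.GeneralLinearGroup (Fin d) ℂ), (∃ g, ρ g ≠ 1) → k ≤ d)
    (ρ : Representation ℂ G V) {g : G} (hg : ρ g ≠ 1) : k ≤ finrank ℂ V := by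
  let φ := LinearMap.toMatrixAlgEquiv (finBasis ℂ V)
  refine hrep _ ((φ : End ℂ V →* _).comp ρ).toHomUnits ⟨g, fun h => hg (φ.injective ?_)⟩
  rw [map_one]
  exact congrArg Units.val h

open Module in
/-- Convolution by a mean-zero function on a quasirandom group has small operator norm. -/
theorem mul_sum_norm_sq_convolution_le {G : Type*} [Group G] [Fintype G] {k : ℕ}
    (hrep : ∀ (d : ℕ) (ρ : G →* Matrix.GeneralLinearGroup (Fin d) ℂ), (∃ g, ρ g ≠ 1) → k ≤ d)
    (w f : G → ℂ) (hw : ∑ x, w x = 0) :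
    k * ∑ x, ‖∑ y, w (x * y⁻¹) * f y‖ ^ 2
      ≤ Fintype.card G * (∑ x, ‖w x‖ ^ 2) * ∑ x, ‖f x‖ ^ 2 := by
  classical
  let M : Matrix G G ℂ := Matrix.of fun x y => w (x * y⁻¹)
  let T : EuclideanSpace ℂ G →ₗ[ℂ] EuclideanSpace ℂ G := Matrix.toEuclideanLin M
  have T_apply (v : EuclideanSpace ℂ G) (x : G) : T v x = ∑ y, w (x * y⁻¹) * v y := by
    simp [T, M, Matrix.toLpLin_apply, Matrix.mulVec, dotProduct]
  have T_const (v : EuclideanSpace ℂ G) (hv : ∀ x, v x = v 1) : T v = 0 := by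
    ext x
    rw [T_apply]
    simp only [hv _, ← Finset.sum_mul]
    rw [← Equiv.sum_comp ((Equiv.inv G).trans (Equiv.mulLeft x))] at hw
    simp only [Equiv.trans_apply, Equiv.inv_apply, Equiv.coe_mulLeft] at hw
    simp [hw]
  let R : Representation ℂ G (EuclideanSpace ℂ G) :=
    { toFun g :=
        { toFun v := WithLp.toLp 2 fun x => v (x * g)
          map_add' u v := by ext; simp
          map_smul' c v := by ext; simp }
      map_one' := by ext v x; simp
      map_mul' g h := by ext v x; simp [mul_assoc] }
  have R_apply (g : G) (v : EuclideanSpace ℂ G) (x : G) : R g v x = v (x * g) := rfl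
  have T_R (g : G) (v : EuclideanSpace ℂ G) : T (R g v) = R g (T v) := by
    ext x
    rw [R_apply, T_apply, T_apply, ← Equiv.sum_comp (Equiv.mulRight g⁻¹)]
    simp [R_apply, mul_assoc]
  have inner_R (g : G) (u v : EuclideanSpace ℂ G) :
      inner ℂ (R g u) v = inner ℂ u (R g⁻¹ v) := by
    simp only [PiLp.inner_apply, R_apply]
    rw [← Equiv.sum_comp (Equiv.mulRight g⁻¹)]
    simp
  have S_R (g : G) (v : EuclideanSpace ℂ G) :
      (T.adjoint ∘ₗ T) (R g v) = R g ((T.adjoint ∘ₗ T) v) := by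
    refine ext_inner_left ℂ fun u => ?_
    have h := inner_R g⁻¹ u ((T.adjoint ∘ₗ T) v)
    rw [inv_inv] at h
    rw [← h]
    simp only [LinearMap.comp_apply, LinearMap.adjoint_inner_right, T_R]
    rw [inner_R, inv_inv]
  have key := T.mul_norm_sq_apply_le_of_le_finrank_eigenspace (EuclideanSpace.basisFun G ℂ) k
    (fun μ hμ hev => by
      have hinv (g : G) : ∀ v ∈ End.eigenspace (T.adjoint ∘ₗ T) μ,
          R g v ∈ End.eigenspace (T.adjoint ∘ₗ T) μ := fun v hv => by
        rw [End.mem_eigenspace_iff] at hv ⊢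
        rw [S_R, hv, map_smul]
      let ρ : Representation ℂ G (End.eigenspace (T.adjoint ∘ₗ T) μ) :=
        { toFun g := (R g).restrict (hinv g)
          map_one' := by ext v x; simp
          map_mul' g h := by ext v x; simp }
      obtain ⟨v, hv, hv0⟩ := hev.exists_hasEigenvector
      have hne : ∃ g, ρ g ≠ 1 := by
        by_contra! hρ
        have hconst (g : G) : v g = v 1 := by
          have h := congrArg (fun L => (L ⟨v, hv⟩ : EuclideanSpace ℂ G) 1) (hρ g)
          simpa [ρ, R_apply] using h
        rw [End.mem_eigenspace_iff, LinearMap.comp_apply, T_const v hconst, map_zero] at hv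
        exact (smul_ne_zero hμ hv0) hv.symm
      obtain ⟨g, hg⟩ := hne
      exact Representation.le_finrank_of_ne_one hrep ρ hg) (WithLp.toLp 2 f)
  have hbasis (y : G) : ‖T (EuclideanSpace.basisFun G ℂ y)‖ ^ 2 = ∑ x, ‖w x‖ ^ 2 := by
    rw [EuclideanSpace.norm_sq_eq, ← Equiv.sum_comp (Equiv.mulRight y)]
    simp [T_apply]
  simp only [hbasis, Finset.sum_const, Finset.card_univ, nsmul_eq_mul] at key
  simpa only [EuclideanSpace.norm_sq_eq, T_apply] using key

/-- The number of solutions of `a * b = c` in a quasirandom group is close to the expected one. -/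
theorem mul_sq_card_product_triples_sub_le {G : Type*} [Group G] [Fintype G] [DecidableEq G]
    {k : ℕ}
    (hrep : ∀ (d : ℕ) (ρ : G →* Matrix.GeneralLinearGroup (Fin d) ℂ), (∃ g, ρ g ≠ 1) → k ≤ d)
    (A B C : Finset G) :
    (k : ℝ) * (((Finset.univ.filter (fun t : G × G × G =>
        t.1 ∈ A ∧ t.2.1 ∈ B ∧ t.2.2 ∈ C ∧ t.1 * t.2.1 = t.2.2)).card : ℝ)
        - A.card * B.card * C.card / Fintype.card G) ^ 2
      ≤ Fintype.card G * (A.card * B.card * C.card) := by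
  set n : ℝ := (Fintype.card G : ℝ) with hn
  have hn0 : 0 < n := Nat.cast_pos.2 Fintype.card_pos
  let w : G → ℝ := fun x => (if x ∈ A then 1 else 0) - A.card / n
  let f : G → ℝ := fun x => if x ∈ B then 1 else 0
  have hw : ∑ x, w x = 0 := by
    simp only [w, Finset.sum_sub_distrib]
    simp [← hn, hn0.ne', mul_div_cancel₀]
  have hw2 : ∑ x, w x ^ 2 ≤ A.card := by
    have h (x : G) : w x ^ 2 = w x * (if x ∈ A then 1 else 0) - w x * (A.card / n) := by
      simp only [w]; ring
    simp only [h, Finset.sum_sub_distrib, ← Finset.sum_mul, hw]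
    simp only [mul_ite, mul_one, mul_zero, Finset.sum_ite_mem, Finset.univ_inter, zero_mul,
      sub_zero]
    calc ∑ x ∈ A, w x ≤ ∑ x ∈ A, 1 := Finset.sum_le_sum fun x hx => by
          simp only [w, hx, if_true]
          linarith [show (0 : ℝ) ≤ A.card / n by positivity]
      _ = A.card := by simp
  have hf2 : ∑ x, f x ^ 2 = B.card := by simp [f]
  have hconv : (k : ℝ) * ∑ x, (∑ y, w (x * y⁻¹) * f y) ^ 2
      ≤ n * (∑ x, w x ^ 2) * ∑ x, f x ^ 2 := by
    have h := mul_sum_norm_sq_convolution_le hrep (fun x => (w x : ℂ)) (fun x => (f x : ℂ))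
      (by exact_mod_cast congrArg (Complex.ofReal) hw)
    simp only [← Complex.ofReal_mul, ← Complex.ofReal_sum, Complex.norm_real, Real.norm_eq_abs,
      sq_abs] at h
    exact h
  have hcount : ((Finset.univ.filter (fun t : G × G × G =>
        t.1 ∈ A ∧ t.2.1 ∈ B ∧ t.2.2 ∈ C ∧ t.1 * t.2.1 = t.2.2)).card : ℝ)
        - A.card * B.card * C.card / n = ∑ x ∈ C, ∑ y, w (x * y⁻¹) * f y := by
    have h1 : (Finset.univ.filter (fun t : G × G × G =>
        t.1 ∈ A ∧ t.2.1 ∈ B ∧ t.2.2 ∈ C ∧ t.1 * t.2.1 = t.2.2)).card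
        = ((C ×ˢ B).filter fun p => p.1 * p.2⁻¹ ∈ A).card := by
      refine Finset.card_bij' (fun t _ => (t.2.2, t.2.1)) (fun p _ => (p.1 * p.2⁻¹, p.2, p.1))
        ?_ ?_ ?_ ?_
      · rintro ⟨a, b, c⟩ h
        simp only [Finset.mem_filter, Finset.mem_univ, true_and] at h
        obtain ⟨ha, hb, hc, rfl⟩ := h
        simp [*]
      · rintro ⟨c, b⟩ h
        simp_all
      · rintro ⟨a, b, c⟩ h
        simp only [Finset.mem_filter, Finset.mem_univ, true_and] at h
        obtain ⟨ha, hb, hc, rfl⟩ := h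
        simp
      · rintro ⟨c, b⟩ h
        rfl
    rw [h1, Finset.card_filter, Finset.sum_product]
    simp only [f, mul_ite, mul_one, mul_zero, Finset.sum_ite_mem, Finset.univ_inter, w,
      Finset.sum_sub_distrib]
    push_cast
    simp only [Finset.sum_const, nsmul_eq_mul]
    ring
  rw [hcount]
  calc (k : ℝ) * (∑ x ∈ C, ∑ y, w (x * y⁻¹) * f y) ^ 2
      ≤ k * (C.card * ∑ x ∈ C, (∑ y, w (x * y⁻¹) * f y) ^ 2) := by
        gcongr
        exact sq_sum_le_card_mul_sum_sq
    _ ≤ k * (C.card * ∑ x, (∑ y, w (x * y⁻¹) * f y) ^ 2) := by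
        gcongr
        exact Finset.subset_univ C
    _ = C.card * (k * ∑ x, (∑ y, w (x * y⁻¹) * f y) ^ 2) := by ring
    _ ≤ C.card * (n * (∑ x, w x ^ 2) * ∑ x, f x ^ 2) := by gcongr
    _ ≤ C.card * (n * A.card * B.card) := by rw [hf2]; gcongr
    _ = n * (A.card * B.card * C.card) := by ring

/-- Theorem 3.3 (Gowers, Quasirandom Groups): if every nontrivial complex
representation of a finite group `Γ` of order `n` has dimension at least `k`,
and `A`, `B`, `C` are subsets of `Γ`, then: (a) if `|A||B||C| > n³/k` (in
particular if each set has size `> n/k^{1/3}`), some `a ∈ A`, `b ∈ B`, `c ∈ C`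
satisfy `ab = c`; (b) if `η > 0` and `|A||B||C| ≥ n³/(η²k)`, the number of such
triples is at least `(1 - η)|A||B||C|/n`. -/
theorem product_triples_in_quasirandom_group
    (Γ : Type) [Group Γ] [Fintype Γ] [DecidableEq Γ] (k : ℕ) (hk0 : 0 < k)
    (hrep : ∀ (d : ℕ) (ρ : Γ →* Matrix.GeneralLinearGroup (Fin d) ℂ),
      (∃ g, ρ g ≠ 1) → k ≤ d)
    (A B C : Finset Γ) :
    (((Fintype.card Γ : ℝ) ^ 3 / (k : ℝ) < (A.card : ℝ) * (B.card : ℝ) * (C.card : ℝ) →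
        ∃ a ∈ A, ∃ b ∈ B, ∃ c ∈ C, a * b = c)
      ∧
      (((Fintype.card Γ : ℝ) / (k : ℝ) ^ ((1 : ℝ) / 3) < (A.card : ℝ) ∧
        (Fintype.card Γ : ℝ) / (k : ℝ) ^ ((1 : ℝ) / 3) < (B.card : ℝ) ∧
        (Fintype.card Γ : ℝ) / (k : ℝ) ^ ((1 : ℝ) / 3) < (C.card : ℝ)) →
        ∃ a ∈ A, ∃ b ∈ B, ∃ c ∈ C, a * b = c))
    ∧
    (∀ η : ℝ, 0 < η →
      (Fintype.card Γ : ℝ) ^ 3 / (η ^ 2 * (k : ℝ)) ≤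
        (A.card : ℝ) * (B.card : ℝ) * (C.card : ℝ) →
      (1 - η) * ((A.card : ℝ) * (B.card : ℝ) * (C.card : ℝ)) / (Fintype.card Γ : ℝ)
        ≤ ((Finset.univ.filter (fun t : Γ × Γ × Γ =>
              t.1 ∈ A ∧ t.2.1 ∈ B ∧ t.2.2 ∈ C ∧ t.1 * t.2.1 = t.2.2)).card : ℝ)) := by
  set n : ℝ := (Fintype.card Γ : ℝ) with hn
  have hn0 : 0 < n := Nat.cast_pos.2 Fintype.card_pos
  have hk : (0 : ℝ) < k := by exact_mod_cast hk0
  have key := mul_sq_card_product_triples_sub_le hrep A B C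
  rw [← hn] at key
  have exists_triple (h : n ^ 3 / k < (A.card : ℝ) * B.card * C.card) :
      ∃ a ∈ A, ∃ b ∈ B, ∃ c ∈ C, a * b = c := by
    by_contra! hno
    rw [Finset.filter_false_of_mem (by
      rintro ⟨a, b, c⟩ - ⟨ha, hb, hc, habc⟩
      exact hno a ha b hb c hc habc)] at key
    set P : ℝ := (A.card : ℝ) * B.card * C.card
    have hP : 0 < P := lt_trans (by positivity) h
    rw [div_lt_iff₀ hk] at h
    rw [Finset.card_empty, Nat.cast_zero, zero_sub, neg_sq, div_pow, mul_div_assoc',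
      div_le_iff₀ (by positivity)] at key
    nlinarith
  refine ⟨⟨exists_triple, fun ⟨hA, hB, hC⟩ => exists_triple ?_⟩, fun η hη h => ?_⟩
  · set r : ℝ := (k : ℝ) ^ ((1 : ℝ) / 3) with hr
    have hr0 : 0 < r := Real.rpow_pos_of_pos hk _
    have hr3 : r ^ 3 = k := by
      rw [hr, ← Real.rpow_natCast, ← Real.rpow_mul hk.le]
      norm_num
    calc n ^ 3 / k = n / r * (n / r) * (n / r) := by rw [← hr3]; field_simp
      _ < (A.card : ℝ) * B.card * C.card := by
        have : 0 < n / r := by positivity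
        gcongr
  · set N : ℝ := ((Finset.univ.filter (fun t : Γ × Γ × Γ =>
      t.1 ∈ A ∧ t.2.1 ∈ B ∧ t.2.2 ∈ C ∧ t.1 * t.2.1 = t.2.2)).card : ℝ)
    set P : ℝ := (A.card : ℝ) * B.card * C.card
    have hP : 0 < P := lt_of_lt_of_le (by positivity) h
    rw [div_le_iff₀ (by positivity)] at h
    have hsq : (N - P / n) ^ 2 ≤ (η * P / n) ^ 2 := by
      refine le_of_mul_le_mul_left (key.trans ?_) hk
      rw [div_pow, mul_div_assoc', le_div_iff₀ (by positivity)]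
      nlinarith
    have habs := (abs_le_of_sq_le_sq' hsq (by positivity)).1
    have : (1 - η) * P / n = P / n - η * P / n := by ring
    linarith
end

section
/- Let q be a prime power, let Γ = PSL₂(q) (the quotient of SL₂(F_q) by its center) and let n = |Γ|. Then Γ has no product-free subset of cardinality greater than 2·n^{8/9}; that is, every subset A ⊆ Γ with |A| > 2·n^{8/9} contains elements x, y, z with xy = z. -/
open Module Module.End in
/-- An upper bound on the eigenvalues of `T† T` bounds the squared operator norm of `T`. -/
theorem LinearMap.norm_apply_sq_le_of_forall_eigenvalue_le {E : Type*} [NormedAddCommGroup E]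
    [InnerProductSpace ℂ E] [FiniteDimensional ℂ E] (T : E →ₗ[ℂ] E) {c : ℝ}
    (hc : ∀ μ : ℝ, HasEigenvalue (T.adjoint ∘ₗ T) (μ : ℂ) → μ ≤ c) (f : E) :
    ‖T f‖ ^ 2 ≤ c * ‖f‖ ^ 2 := by
  have hS : (T.adjoint ∘ₗ T).IsSymmetric := T.isPositive_adjoint_comp_self.isSymmetric
  let b := hS.eigenvectorBasis rfl
  have key : inner ℂ f ((T.adjoint ∘ₗ T) f)
      = ((∑ i, hS.eigenvalues rfl i * ‖inner ℂ (b i) f‖ ^ 2 : ℝ) : ℂ) := by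
    rw [← b.sum_inner_mul_inner, Complex.ofReal_sum]
    refine Finset.sum_congr rfl fun i _ => ?_
    rw [← hS (b i) f, hS.apply_eigenvectorBasis rfl i, inner_smul_left,
      ← inner_conj_symm f (b i), mul_left_comm, Complex.conj_mul']
    simp
  have hT : inner ℂ f ((T.adjoint ∘ₗ T) f) = ((‖T f‖ ^ 2 : ℝ) : ℂ) := by
    rw [LinearMap.comp_apply, LinearMap.adjoint_inner_right, inner_self_eq_norm_sq_to_K]
    simp
  rw [hT, Complex.ofReal_inj] at key
  rw [key, ← b.sum_sq_norm_inner_right f, Finset.mul_sum]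
  gcongr with i
  exact hc _ (hS.hasEigenvalue_eigenvalues rfl i)

section Convolution

variable {G : Type*} [Group G]

/-- The action of a group by right translation on its complex functions. -/
noncomputable def rightRegular (G : Type*) [Group G] :
    Representation ℂ G (EuclideanSpace ℂ G) where
  toFun h :=
    { toFun := fun f => WithLp.toLp 2 fun x => f (x * h)
      map_add' := fun _ _ => rfl
      map_smul' := fun _ _ => rfl }
  map_one' := by ext; simp
  map_mul' h k := by ext f x; exact congrArg f (mul_assoc x h k).symm

@[simp]
theorem rightRegular_apply (h x : G) (f : EuclideanSpace ℂ G) :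
    rightRegular G h f x = f (x * h) := rfl

variable [Fintype G]

theorem inner_rightRegular_left (h : G) (f g : EuclideanSpace ℂ G) :
    inner ℂ (rightRegular G h f) g = inner ℂ f (rightRegular G h⁻¹ g) := by
  simp only [PiLp.inner_apply, rightRegular_apply]
  exact Fintype.sum_equiv (Equiv.mulRight h) _ _ fun x => by simp

theorem adjoint_rightRegular (h : G) :
    (rightRegular G h).adjoint = rightRegular G h⁻¹ :=
  ((LinearMap.eq_adjoint_iff _ _).2 fun f g => by rw [inner_rightRegular_left, inv_inv]).symm

/-- The operator on functions on `G` with kernel `(x, y) ↦ k (y * x⁻¹)`. -/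
noncomputable def kernelOperator (k : G → ℂ) :
    EuclideanSpace ℂ G →ₗ[ℂ] EuclideanSpace ℂ G where
  toFun f := WithLp.toLp 2 fun x => ∑ y, k (y * x⁻¹) * f y
  map_add' f g := by ext; simp [mul_add, Finset.sum_add_distrib]
  map_smul' c f := by ext; simp [Finset.mul_sum, mul_left_comm]

theorem kernelOperator_apply (k : G → ℂ) (f : EuclideanSpace ℂ G) (x : G) :
    kernelOperator k f x = ∑ y, k (y * x⁻¹) * f y := rfl

theorem commute_rightRegular_kernelOperator (k : G → ℂ) (h : G) :
    Commute (rightRegular G h) (kernelOperator k) := by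
  ext f x
  simp only [Module.End.mul_apply, rightRegular_apply, kernelOperator_apply]
  exact (Fintype.sum_equiv (Equiv.mulRight h) _ _ fun y => by simp [mul_assoc]).symm

theorem commute_rightRegular_adjoint_comp_kernelOperator (k : G → ℂ) (h : G) :
    Commute (rightRegular G h) ((kernelOperator k).adjoint ∘ₗ kernelOperator k) := by
  refine Commute.mul_right ?_ (commute_rightRegular_kernelOperator k h)
  have := congrArg LinearMap.adjoint (commute_rightRegular_kernelOperator k h⁻¹).eq
  simp only [Module.End.mul_eq_comp, LinearMap.adjoint_comp, adjoint_rightRegular, inv_inv] at this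
  exact this.symm

theorem kernelOperator_eq_zero_of_forall_apply_eq {k : G → ℂ} (hk : ∑ x, k x = 0)
    {f : EuclideanSpace ℂ G} (hf : ∀ x, f x = f 1) : kernelOperator k f = 0 := by
  ext x
  rw [kernelOperator_apply]
  simp_rw [hf, ← Finset.sum_mul]
  rw [Fintype.sum_equiv (Equiv.mulRight x⁻¹) (fun y => k (y * x⁻¹)) k fun y => rfl, hk]
  simp

/-- Bessel's inequality: the squared norms of the images of an orthonormal family add up to at most
the squared Hilbert-Schmidt norm. -/
theorem sum_norm_kernelOperator_sq_le {ι : Type*} [Fintype ι] (k : G → ℂ)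
    {v : ι → EuclideanSpace ℂ G} (hv : Orthonormal ℂ v) :
    ∑ i, ‖kernelOperator k (v i)‖ ^ 2 ≤ Fintype.card G * ∑ x, ‖k x‖ ^ 2 := by
  let row (x : G) : EuclideanSpace ℂ G := WithLp.toLp 2 fun y => star (k (y * x⁻¹))
  have hrow (x : G) (f : EuclideanSpace ℂ G) :
      ‖kernelOperator k f x‖ = ‖inner ℂ f (row x)‖ := by
    rw [norm_inner_symm, kernelOperator_apply, PiLp.inner_apply]
    simp [row, mul_comm]
  have hnorm (x : G) : ‖row x‖ ^ 2 = ∑ y, ‖k y‖ ^ 2 := by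
    rw [EuclideanSpace.norm_sq_eq]
    exact Fintype.sum_equiv (Equiv.mulRight x⁻¹) _ _ fun y => by simp [row]
  simp_rw [EuclideanSpace.norm_sq_eq, hrow]
  rw [Finset.sum_comm]
  calc ∑ x, ∑ i, ‖inner ℂ (v i) (row x)‖ ^ 2 ≤ ∑ x, ‖row x‖ ^ 2 :=
        Finset.sum_le_sum fun x _ => hv.sum_inner_products_le (row x)
    _ = _ := by simp [hnorm]

open Module Module.End in
/-- In a group without nontrivial representations of dimension below `d`, the operator with a
mean-zero kernel is small. -/
theorem mul_norm_kernelOperator_sq_le {d : ℕ} (hd : 0 < d)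
    (hG : ∀ W : Submodule ℂ (EuclideanSpace ℂ G), ∀ ρ : Representation ℂ G W,
      ρ ≠ 1 → d ≤ finrank ℂ W)
    {k : G → ℂ} (hk : ∑ x, k x = 0) (f : EuclideanSpace ℂ G) :
    d * ‖kernelOperator k f‖ ^ 2 ≤ Fintype.card G * (∑ x, ‖k x‖ ^ 2) * ‖f‖ ^ 2 := by
  have hd' : (0 : ℝ) < d := by exact_mod_cast hd
  set T := kernelOperator k
  rw [← le_div_iff₀' hd', mul_div_right_comm]
  refine T.norm_apply_sq_le_of_forall_eigenvalue_le (fun μ hμ => ?_) f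
  rw [le_div_iff₀' hd']
  have hnorm {g : EuclideanSpace ℂ G} (hg : g ∈ eigenspace (T.adjoint ∘ₗ T) (μ : ℂ)) :
      ‖T g‖ ^ 2 = μ * ‖g‖ ^ 2 := by
    have : inner ℂ (T g) (T g) = (μ : ℂ) * inner ℂ g g := by
      rw [← inner_smul_right, ← mem_eigenspace_iff.1 hg, LinearMap.comp_apply,
        LinearMap.adjoint_inner_right]
    simp only [inner_self_eq_norm_sq_to_K] at this
    rw [← Complex.ofReal_inj]
    simpa using this
  have hinv (h : G) : ∀ g ∈ eigenspace (T.adjoint ∘ₗ T) (μ : ℂ),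
      rightRegular G h g ∈ eigenspace (T.adjoint ∘ₗ T) (μ : ℂ) :=
    mapsTo_genEigenspace_of_comm (commute_rightRegular_adjoint_comp_kernelOperator k h).symm _ _
  set W := eigenspace (T.adjoint ∘ₗ T) (μ : ℂ)
  by_cases htriv : (rightRegular G).subrepresentation W hinv = 1
  · obtain ⟨g, hgW, hg0⟩ := hμ.exists_hasEigenvector
    have hconst (x : G) : g x = g 1 := by
      have := congrArg Subtype.val (LinearMap.congr_fun (DFunLike.congr_fun htriv x) ⟨g, hgW⟩)
      simpa using congrArg (fun f : EuclideanSpace ℂ G => f 1) this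
    have hμ0 : μ = 0 := by
      have := hnorm hgW
      rw [kernelOperator_eq_zero_of_forall_apply_eq hk hconst] at this
      simpa [hg0] using this
    rw [hμ0, mul_zero]
    positivity
  · have hdim := hG W _ htriv
    let b := stdOrthonormalBasis ℂ W
    have hb : Orthonormal ℂ fun i => (b i : EuclideanSpace ℂ G) :=
      b.orthonormal.comp_linearIsometry W.subtypeₗᵢ
    have hsum := sum_norm_kernelOperator_sq_le k hb
    have hTb (i) : ‖T (b i)‖ ^ 2 = μ := by rw [hnorm (b i).2, hb.1 i]; simp
    have hμ0 : 0 ≤ μ := by rw [← hTb ⟨0, by omega⟩]; positivity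
    refine le_trans ?_ hsum
    change _ ≤ ∑ i, ‖T (b i)‖ ^ 2
    simp only [hTb, Finset.sum_const, Finset.card_univ, Fintype.card_fin, nsmul_eq_mul]
    gcongr

open Module in
/-- Gowers' bound on the size of a product-free set in a quasirandom group. -/
theorem mul_card_pow_three_le_of_productFree {d : ℕ} (hd : 0 < d)
    (hG : ∀ W : Submodule ℂ (EuclideanSpace ℂ G), ∀ ρ : Representation ℂ G W,
      ρ ≠ 1 → d ≤ finrank ℂ W)
    {A : Finset G} (hA : ∀ x ∈ A, ∀ y ∈ A, x * y ∉ A) :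
    d * A.card ^ 3 ≤ Fintype.card G ^ 3 := by
  classical
  rcases A.eq_empty_or_nonempty with rfl | hne
  · simp
  have hn : (0 : ℝ) < Fintype.card G := by exact_mod_cast Fintype.card_pos
  have hm : (0 : ℝ) < A.card := by exact_mod_cast hne.card_pos
  set n : ℝ := (Fintype.card G : ℝ) with hn_def
  set m : ℝ := (A.card : ℝ) with hm_def
  let r (x : G) : ℝ := if x ∈ A then 1 else 0
  have hr : ∑ x, r x = m := by simp [r, hm_def]
  have hr2 : ∑ x, r x ^ 2 = m := by simp [r, hm_def]
  let k (x : G) : ℂ := ((r x - m / n : ℝ) : ℂ)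
  let f : EuclideanSpace ℂ G := WithLp.toLp 2 fun x => (r x : ℂ)
  have hk : ∑ x, k x = 0 := by
    rw [← Complex.ofReal_sum, Finset.sum_sub_distrib, hr, Complex.ofReal_eq_zero]
    simp [← hn_def]
    field_simp
    simp
  have hk2 : ∑ x, ‖k x‖ ^ 2 ≤ m := by
    have (x : G) : ‖k x‖ ^ 2 = r x ^ 2 - 2 * (m / n) * r x + (m / n) ^ 2 := by
      simp only [k, Complex.norm_real, Real.norm_eq_abs, sq_abs]; ring
    simp_rw [this]
    rw [Finset.sum_add_distrib, Finset.sum_sub_distrib, ← Finset.mul_sum, hr, hr2]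
    simp only [Finset.sum_const, Finset.card_univ, nsmul_eq_mul, ← hn_def]
    have : m - 2 * (m / n) * m + n * (m / n) ^ 2 = m - m ^ 2 / n := by field_simp; ring
    rw [this]
    linarith [show 0 ≤ m ^ 2 / n by positivity]
  have hf2 : ‖f‖ ^ 2 = m := by
    rw [EuclideanSpace.norm_sq_eq, ← hr2]
    simp [f]
  have hinner : inner ℂ f (kernelOperator k f) = ((-(m ^ 3 / n) : ℝ) : ℂ) := by
    have hrow (x : G) (hx : x ∈ A) : kernelOperator k f x = ((-(m ^ 2 / n) : ℝ) : ℂ) := by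
      rw [kernelOperator_apply]
      have (y : G) : k (y * x⁻¹) * f y = ((-(m / n) * r y : ℝ) : ℂ) := by
        by_cases hy : y ∈ A
        · have hyx : y * x⁻¹ ∉ A := fun h => hA _ h x hx (by simpa using hy)
          simp [k, f, r, hy, hyx]
        · simp [f, r, hy]
      simp_rw [this]
      rw [← Complex.ofReal_sum, ← Finset.mul_sum, hr]
      congr 1; ring
    rw [PiLp.inner_apply]
    have (x : G) : inner ℂ (f x) (kernelOperator k f x) = ((-(m ^ 2 / n) * r x : ℝ) : ℂ) := by
      by_cases hx : x ∈ A
      · rw [hrow x hx]; simp [f, r, hx]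
      · simp [f, r, hx]
    simp_rw [this]
    rw [← Complex.ofReal_sum, ← Finset.mul_sum, hr]
    congr 1; ring
  have hcs : m ^ 3 / n ≤ ‖f‖ * ‖kernelOperator k f‖ := by
    have := norm_inner_le_norm (𝕜 := ℂ) f (kernelOperator k f)
    rwa [hinner, Complex.norm_real, norm_neg, Real.norm_of_nonneg (by positivity)] at this
  have hop := mul_norm_kernelOperator_sq_le hd hG hk f
  have hsq : (m ^ 3 / n) ^ 2 ≤ m * ‖kernelOperator k f‖ ^ 2 := by
    calc (m ^ 3 / n) ^ 2 ≤ (‖f‖ * ‖kernelOperator k f‖) ^ 2 := by gcongr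
      _ = m * ‖kernelOperator k f‖ ^ 2 := by rw [mul_pow, hf2]
  have hfinal : (d : ℝ) * m ^ 3 ≤ n ^ 3 := by
    have h1 : d * (m ^ 3 / n) ^ 2 ≤ m * (n * m * m) :=
      calc d * (m ^ 3 / n) ^ 2 ≤ d * (m * ‖kernelOperator k f‖ ^ 2) := by gcongr
        _ = m * (d * ‖kernelOperator k f‖ ^ 2) := by ring
        _ ≤ m * (n * (∑ x, ‖k x‖ ^ 2) * ‖f‖ ^ 2) := by gcongr
        _ ≤ m * (n * m * m) := by rw [hf2]; gcongr
    have h2 : d * (m ^ 3 / n) ^ 2 = (d * m ^ 3) * (m ^ 3 / n ^ 2) := by ring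
    have h3 : m * (n * m * m) = n ^ 3 * (m ^ 3 / n ^ 2) := by field_simp
    rw [h2, h3] at h1
    exact le_of_mul_le_mul_right h1 (by positivity)
  rw [hn_def, hm_def] at hfinal
  exact_mod_cast hfinal

end Convolution

section SpecialLinear

open Matrix Matrix.SpecialLinearGroup Module

variable {F : Type*} [Field F]

/-- The upper unipotent matrix with off-diagonal entry `t`. -/
def upperUnipotent (t : F) : SpecialLinearGroup (Fin 2) F :=
  ⟨!![1, t; 0, 1], by simp⟩

/-- The lower unipotent matrix with off-diagonal entry `t`. -/
def lowerUnipotent (t : F) : SpecialLinearGroup (Fin 2) F :=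
  ⟨!![1, 0; t, 1], by simp⟩

/-- The diagonal matrix with entries `a` and `a⁻¹`. -/
def diagonalUnit (a : Fˣ) : SpecialLinearGroup (Fin 2) F :=
  ⟨!![(a : F), 0; 0, ((a⁻¹ : Fˣ) : F)], by simp⟩

/-- The Weyl element of `SL₂`. -/
def weylElement : SpecialLinearGroup (Fin 2) F :=
  ⟨!![0, 1; -1, 0], by simp⟩

@[simp]
theorem coe_upperUnipotent (t : F) :
    (upperUnipotent t : Matrix (Fin 2) (Fin 2) F) = !![1, t; 0, 1] := rfl

@[simp]
theorem coe_lowerUnipotent (t : F) :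
    (lowerUnipotent t : Matrix (Fin 2) (Fin 2) F) = !![1, 0; t, 1] := rfl

@[simp]
theorem coe_diagonalUnit (a : Fˣ) :
    (diagonalUnit a : Matrix (Fin 2) (Fin 2) F) = !![(a : F), 0; 0, ((a⁻¹ : Fˣ) : F)] := rfl

@[simp]
theorem coe_weylElement :
    ((weylElement : SpecialLinearGroup (Fin 2) F) : Matrix (Fin 2) (Fin 2) F) = !![0, 1; -1, 0] := rfl

theorem upperUnipotent_zero : upperUnipotent (0 : F) = 1 := by
  ext i j; fin_cases i <;> fin_cases j <;> simp

theorem upperUnipotent_add (s t : F) :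
    upperUnipotent (s + t) = upperUnipotent s * upperUnipotent t := by
  ext i j; fin_cases i <;> fin_cases j <;> simp [add_comm]

theorem upperUnipotent_mul_diagonalUnit (a : Fˣ) (t : F) :
    upperUnipotent ((a : F) ^ 2 * t) * diagonalUnit a = diagonalUnit a * upperUnipotent t := by
  ext i j; fin_cases i <;> fin_cases j <;> simp
  field_simp

theorem lowerUnipotent_mul_weylElement (t : F) :
    lowerUnipotent t * weylElement = weylElement * upperUnipotent (-t) := by
  ext i j; fin_cases i <;> fin_cases j <;> simp

theorem eq_mul_unipotent_of_ne_zero (g : SpecialLinearGroup (Fin 2) F) (hg : g 1 0 ≠ 0) :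
    g = upperUnipotent ((g 0 0 - 1) / g 1 0) * lowerUnipotent (g 1 0) *
      upperUnipotent ((g 1 1 - 1) / g 1 0) := by
  have hdet := g.det_coe
  rw [det_fin_two] at hdet
  have h01 : g 0 1 = (g 0 0 * g 1 1 - 1) / g 1 0 := by
    rw [eq_div_iff hg]; linear_combination -hdet
  ext i j; fin_cases i <;> fin_cases j <;> simp
  · field_simp; ring
  · rw [h01]; field_simp; ring
  · field_simp; ring

/-- A homomorphism from `SL₂` that kills the upper unipotent matrices is trivial. -/
theorem MonoidHom.eq_one_of_upperUnipotent {M : Type*} [Monoid M]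
    (φ : SpecialLinearGroup (Fin 2) F →* M) (h : ∀ t, φ (upperUnipotent t) = 1) : φ = 1 := by
  have hlow (t : F) : φ (lowerUnipotent t) = 1 := by
    rw [eq_mul_inv_of_mul_eq (lowerUnipotent_mul_weylElement t), map_mul, map_mul, h, mul_one,
      ← map_mul, mul_inv_cancel, map_one]
  have hne (g : SpecialLinearGroup (Fin 2) F) (hg : g 1 0 ≠ 0) : φ g = 1 := by
    rw [eq_mul_unipotent_of_ne_zero g hg]
    simp [h, hlow]
  ext g
  by_cases hg : g 1 0 = 0
  · have hdet := g.det_coe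
    rw [det_fin_two, hg, mul_zero, sub_zero] at hdet
    have hg' : (g * lowerUnipotent 1 : SpecialLinearGroup (Fin 2) F) 1 0 ≠ 0 := by
      simpa [Matrix.mul_apply, hg] using right_ne_zero_of_mul_eq_one hdet
    simpa [hlow] using hne _ hg'
  · exact hne g hg

theorem card_specialLinearGroup_le [Fintype F] :
    Nat.card (SpecialLinearGroup (Fin 2) F) ≤ Fintype.card F ^ 3 := by
  classical
  have hinj : Function.Injective fun g : SpecialLinearGroup (Fin 2) F =>
      (g 0 0, g 0 1, if g 0 0 = 0 then g 1 1 else g 1 0) := by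
    intro g h hgh
    simp only [Prod.mk.injEq] at hgh
    obtain ⟨h00, h01, h1⟩ := hgh
    have hg := g.det_coe
    have hh := h.det_coe
    rw [det_fin_two] at hg hh
    rw [← h00] at h1
    rw [← h00, ← h01] at hh
    have : g 1 0 = h 1 0 ∧ g 1 1 = h 1 1 := by
      by_cases h0 : g 0 0 = 0
      · simp only [h0, if_true, zero_mul, zero_sub] at h1 hg hh
        have h01' : g 0 1 ≠ 0 := fun h => by simp [h] at hg
        exact ⟨mul_left_cancel₀ h01' (by linear_combination hh - hg), h1⟩
      · simp only [h0, if_false] at h1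
        rw [← h1] at hh
        exact ⟨h1, mul_left_cancel₀ h0 (by linear_combination hg - hh)⟩
    ext i j; fin_cases i <;> fin_cases j
    exacts [h00, h01, this.1, this.2]
  have := Nat.card_le_card_of_injective _ hinj
  simpa [Nat.card_prod, pow_succ, mul_assoc] using this

variable {V : Type*} [AddCommGroup V] [Module ℂ V] [Fintype F]
  (ρ : Representation ℂ (SpecialLinearGroup (Fin 2) F) V)

/-- Up to the factor `|F|`, the projection to the `ψ`-isotypic part of a representation of `SL₂`
restricted to the upper unipotent subgroup. -/
noncomputable def unipotentProjection (ψ : AddChar F ℂ) : V →ₗ[ℂ] V :=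
  ∑ t, ψ (-t) • ρ (upperUnipotent t)

theorem unipotentProjection_apply (ψ : AddChar F ℂ) (v : V) :
    unipotentProjection ρ ψ v = ∑ t, ψ (-t) • ρ (upperUnipotent t) v := by
  simp [unipotentProjection]

theorem rho_upperUnipotent_unipotentProjection (ψ : AddChar F ℂ) (v : V) (s : F) :
    ρ (upperUnipotent s) (unipotentProjection ρ ψ v) = ψ s • unipotentProjection ρ ψ v := by
  simp only [unipotentProjection_apply, map_sum, map_smul, Finset.smul_sum, smul_smul]
  refine Fintype.sum_equiv (Equiv.addLeft s) _ _ fun t => ?_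
  rw [Equiv.coe_addLeft, upperUnipotent_add, map_mul, Module.End.mul_apply,
    ← AddChar.map_add_eq_mul]
  congr 2
  ring

theorem unipotentProjection_apply_of_forall_eq_smul [DecidableEq (AddChar F ℂ)]
    {ψ χ : AddChar F ℂ} {v : V}
    (hv : ∀ t, ρ (upperUnipotent t) v = χ t • v) :
    unipotentProjection ρ ψ v = if χ = ψ then (Fintype.card F : ℂ) • v else 0 := by
  have : unipotentProjection ρ ψ v = (∑ t, (χ - ψ) t) • v := by
    simp_rw [unipotentProjection_apply, hv, smul_smul, Finset.sum_smul, AddChar.sub_apply,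
      mul_comm]
  rw [this, AddChar.sum_eq_ite]
  simp [sub_eq_zero]

theorem sum_unipotentProjection (v : V) :
    ∑ ψ, unipotentProjection ρ ψ v = (Fintype.card F : ℂ) • v := by
  classical
  simp_rw [unipotentProjection_apply]
  rw [Finset.sum_comm]
  simp_rw [← Finset.sum_smul, AddChar.sum_apply_eq_ite]
  simp [upperUnipotent_zero]

/-- Vectors on which the upper unipotent subgroup acts through distinct characters are linearly
independent. -/
theorem linearIndependent_of_unipotent_characters {ι : Type*} {v : ι → V} {χ : ι → AddChar F ℂ}
    (hχ : Function.Injective χ) (hv : ∀ i t, ρ (upperUnipotent t) (v i) = χ i t • v i)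
    (hv0 : ∀ i, v i ≠ 0) : LinearIndependent ℂ v := by
  classical
  rw [linearIndependent_iff']
  intro s c hc i hi
  have := congrArg (unipotentProjection ρ (χ i)) hc
  simp only [map_sum, map_smul, unipotentProjection_apply_of_forall_eq_smul ρ (hv _), map_zero,
    hχ.eq_iff, smul_ite, smul_zero, Finset.sum_ite_eq', hi, if_true] at this
  simpa [hv0 i] using this

theorem exists_unipotentProjection_ne_zero (hρ : ρ ≠ 1) :
    ∃ ψ : AddChar F ℂ, ψ ≠ 0 ∧ ∃ v, unipotentProjection ρ ψ v ≠ 0 := by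
  contrapose! hρ
  refine MonoidHom.eq_one_of_upperUnipotent ρ fun t => LinearMap.ext fun v => ?_
  have hv : (Fintype.card F : ℂ) • v = unipotentProjection ρ 0 v := by
    rw [← sum_unipotentProjection ρ v]
    exact Finset.sum_eq_single _ (fun ψ _ hψ => hρ ψ hψ v) (by simp)
  have ht := rho_upperUnipotent_unipotentProjection ρ 0 v t
  rw [← hv, map_smul, AddChar.zero_apply, one_smul] at ht
  exact smul_right_injective V (by simp : (Fintype.card F : ℂ) ≠ 0) ht

theorem card_sub_one_le_two_mul_card_squares [DecidableEq F] :
    Fintype.card F - 1 ≤ 2 * (Finset.univ.image fun a : Fˣ => a ^ 2).card := by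
  rw [← Fintype.card_units, ← Finset.card_univ]
  refine Finset.card_le_mul_card_image _ _ fun b hb => ?_
  obtain ⟨a, -, rfl⟩ := Finset.mem_image.1 hb
  have hsub : ({c | c ^ 2 = a ^ 2} : Finset Fˣ) ⊆ {a, -a} := fun c hc => by
    simpa using Units.eq_or_eq_neg_of_sq_eq_sq c a (by simpa using hc)
  exact (Finset.card_le_card hsub).trans Finset.card_le_two

/-- A nontrivial complex representation of `SL₂(q)` has dimension at least `(q - 1) / 2`. -/
theorem card_sub_one_le_two_mul_finrank [FiniteDimensional ℂ V] (hρ : ρ ≠ 1) :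
    Fintype.card F - 1 ≤ 2 * finrank ℂ V := by
  classical
  obtain ⟨ψ, hψ, w, hw⟩ := exists_unipotentProjection_ne_zero ρ hρ
  set u := unipotentProjection ρ ψ w
  let S := Finset.univ.image fun a : Fˣ => a ^ 2
  have hroot (s : S) : ∃ a : Fˣ, a ^ 2 = s := by
    obtain ⟨a, -, ha⟩ := Finset.mem_image.1 s.2
    exact ⟨a, ha⟩
  choose a ha using hroot
  let χ (s : S) : AddChar F ℂ := ψ.mulShift (((s : Fˣ)⁻¹ : Fˣ) : F)
  have hχ : Function.Injective χ := by
    intro s s' h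
    have := AddChar.to_mulShift_inj_of_isPrimitive (AddChar.IsPrimitive.of_ne_one hψ) h
    exact Subtype.ext (inv_injective (Units.ext this))
  have hchar (s : S) (t : F) : ρ (upperUnipotent t) (ρ (diagonalUnit (a s)) u)
      = χ s t • ρ (diagonalUnit (a s)) u := by
    have := upperUnipotent_mul_diagonalUnit (a s) ((((s : Fˣ)⁻¹ : Fˣ) : F) * t)
    rw [← mul_assoc, ← Units.val_pow_eq_pow_val, ha, Units.mul_inv, one_mul] at this
    rw [← Module.End.mul_apply, ← map_mul, this, map_mul, Module.End.mul_apply,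
      rho_upperUnipotent_unipotentProjection, map_smul]
    rfl
  have hne (s : S) : ρ (diagonalUnit (a s)) u ≠ 0 := fun h => hw <| by
    have := congrArg (ρ (diagonalUnit (a s))⁻¹) h
    simpa using this
  have hli := linearIndependent_of_unipotent_characters ρ hχ hchar hne
  have hcard := hli.fintype_card_le_finrank
  rw [Fintype.card_coe] at hcard
  exact card_sub_one_le_two_mul_card_squares.trans (Nat.mul_le_mul_left 2 hcard)

end SpecialLinear

/-- Corollary 3.4 (Gowers, Quasirandom Groups): `PSL₂(q)` has no product-free
subset of cardinality greater than `2 n^{8/9}`, where `n = |PSL₂(q)|`. -/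
theorem psl2_no_large_product_free_subset
    (q : ℕ) (hq : IsPrimePow q)
    (F : Type) [Field F] [Fintype F] (hF : Fintype.card F = q)
    (A : Set (Matrix.SpecialLinearGroup (Fin 2) F ⧸
          Subgroup.center (Matrix.SpecialLinearGroup (Fin 2) F)))
    (hA : 2 * (Nat.card (Matrix.SpecialLinearGroup (Fin 2) F ⧸
            Subgroup.center (Matrix.SpecialLinearGroup (Fin 2) F)) : ℝ) ^ ((8 : ℝ) / 9)
          < (Nat.card A : ℝ)) :
    ∃ x ∈ A, ∃ y ∈ A, ∃ z ∈ A, x * y = z := by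
  classical
  by_contra! hfree
  let Γ := Matrix.SpecialLinearGroup (Fin 2) F ⧸
    Subgroup.center (Matrix.SpecialLinearGroup (Fin 2) F)
  have := Fintype.ofFinite Γ
  have hq1 : 1 < q := hq.one_lt
  have hrep (W : Submodule ℂ (EuclideanSpace ℂ Γ)) (ρ : Representation ℂ Γ W) (hρ : ρ ≠ 1) :
      q / 2 ≤ Module.finrank ℂ W := by
    have hρ' : (ρ.comp (QuotientGroup.mk' _) :
        Representation ℂ (Matrix.SpecialLinearGroup (Fin 2) F) W) ≠ 1 := fun h =>
      hρ <| (MonoidHom.cancel_right (QuotientGroup.mk'_surjective _)).1 (h.trans (by ext; simp))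
    have := card_sub_one_le_two_mul_finrank _ hρ'
    rw [hF] at this
    omega
  have hgowers := mul_card_pow_three_le_of_productFree (A := A.toFinset) (by omega) hrep
    (fun x hx y hy hxy => by
      simp only [Set.mem_toFinset] at hx hy hxy
      exact hfree x hx y hy _ hxy rfl)
  have hcard : Nat.card Γ ≤ q ^ 3 := by
    rw [← hF]
    exact (Nat.card_le_card_of_surjective _ (QuotientGroup.mk'_surjective _)).trans
      card_specialLinearGroup_le
  rw [Set.toFinset_card, ← Nat.card_eq_fintype_card, ← Nat.card_eq_fintype_card] at hgowers
  have hn : 0 < Nat.card Γ := Nat.card_pos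
  generalize Nat.card Γ = n at *
  generalize Nat.card A = m at *
  have hn' : (0 : ℝ) < n := by exact_mod_cast hn
  set c : ℝ := (n : ℝ) ^ ((1 : ℝ) / 3) with hc_def
  have hc : 0 < c := Real.rpow_pos_of_pos hn' _
  have hc3 : c ^ 3 = n := by
    rw [hc_def, ← Real.rpow_natCast, ← Real.rpow_mul hn'.le]; norm_num
  have hc8 : ((n : ℝ) ^ ((8 : ℝ) / 9)) ^ 3 = c ^ 8 := by
    rw [hc_def, ← Real.rpow_natCast, ← Real.rpow_natCast, ← Real.rpow_mul hn'.le,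
      ← Real.rpow_mul hn'.le]
    norm_num
  have hcq : c ≤ q := by
    refine le_of_pow_le_pow_left₀ three_ne_zero (by positivity) ?_
    rw [hc3]
    exact_mod_cast hcard
  have hm : 8 * c ^ 8 < (m : ℝ) ^ 3 := by
    rw [← hc8]
    calc 8 * ((n : ℝ) ^ ((8 : ℝ) / 9)) ^ 3 = (2 * (n : ℝ) ^ ((8 : ℝ) / 9)) ^ 3 := by ring
      _ < (m : ℝ) ^ 3 := by gcongr
  have hd : (q : ℝ) ≤ 4 * ((q / 2 : ℕ) : ℝ) := by
    exact_mod_cast (by omega : q ≤ 4 * (q / 2))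
  have hg : ((q / 2 : ℕ) : ℝ) * (m : ℝ) ^ 3 ≤ c ^ 9 := by
    calc ((q / 2 : ℕ) : ℝ) * (m : ℝ) ^ 3 ≤ (n : ℝ) ^ 3 := by exact_mod_cast hgowers
      _ = c ^ 9 := by rw [← hc3]; ring
  have : c / 4 * (8 * c ^ 8) ≤ c ^ 9 :=
    (mul_le_mul (by linarith) hm.le (by positivity) (by positivity)).trans hg
  have hc9 : 0 < c ^ 9 := by positivity
  linarith [show c / 4 * (8 * c ^ 8) = 2 * c ^ 9 by ring]
end

section
/- Let G be a finite group of order n such that every nontrivial complex representation of G has dimension at least k. Let A and B be subsets of G with |A| = rn and |B| = sn, and let δ > 0 and t > 0. Then, provided that r·s·t ≥ 1/(δ²·k), the number of group elements x ∈ G for which |A ∩ xB| ≤ (1−δ)·r·s·n is at most t·n, where xB = {xb : b ∈ B}. -/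
open scoped InnerProductSpace

namespace LinearMap

/-- If every positive eigenvalue of a positive operator `T` has multiplicity at least `k`, then the
largest eigenvalue of `T` is at most `tr T / k`. -/
lemma IsPositive.mul_re_inner_le_re_trace {E : Type*} [NormedAddCommGroup E]
    [InnerProductSpace ℂ E] [FiniteDimensional ℂ E] {T : E →ₗ[ℂ] E} (hT : T.IsPositive) {k : ℕ}
    (hk : ∀ μ : ℂ, μ ≠ 0 → Module.End.HasEigenvalue T μ →
      k ≤ Module.finrank ℂ (Module.End.eigenspace T μ)) (v : E) :
    k * (⟪v, T v⟫_ℂ).re ≤ (T.trace ℂ E).re * ‖v‖ ^ 2 := by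
  have hS := hT.isSymmetric
  let ev := hS.eigenvalues rfl
  let b := hS.eigenvectorBasis rfl
  have hev : ∀ i, 0 ≤ ev i := hT.nonneg_eigenvalues rfl
  have htr : (T.trace ℂ E).re = ∑ i, ev i := hS.re_trace_eq_sum_eigenvalues rfl
  have hev_le (i) : k * ev i ≤ (T.trace ℂ E).re := by
    rcases eq_or_ne (ev i) 0 with h0 | h0
    · rw [h0, mul_zero, htr]
      exact Finset.sum_nonneg fun j _ => hev j
    · have hmult : k ≤ (Finset.univ.filter fun j => ev j = ev i).card := by
        have h := hk (ev i) (by exact_mod_cast h0) (hS.hasEigenvalue_eigenvalues rfl i)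
        rw [← hS.card_filter_eigenvalues_eq rfl] at h
        simpa [ev] using h
      calc (k : ℝ) * ev i
          ≤ (Finset.univ.filter fun j => ev j = ev i).card * ev i :=
            mul_le_mul_of_nonneg_right (by exact_mod_cast hmult) (hev i)
        _ = ∑ j with ev j = ev i, ev j := by
            rw [← nsmul_eq_mul, ← Finset.sum_const]
            refine Finset.sum_congr rfl fun j hj => ?_
            exact (Finset.mem_filter.mp hj).2.symm
        _ ≤ ∑ j, ev j :=
            Finset.sum_le_univ_sum_of_nonneg hev
        _ = _ := htr.symm
  have hinner : (⟪v, T v⟫_ℂ).re = ∑ i, ev i * ‖⟪b i, v⟫_ℂ‖ ^ 2 := by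
    rw [← b.sum_inner_mul_inner, Complex.re_sum]
    refine Finset.sum_congr rfl fun i _ => ?_
    rw [← hS (b i) v, hS.apply_eigenvectorBasis, inner_smul_left, RCLike.conj_ofReal,
      mul_left_comm]
    refine (Complex.re_ofReal_mul _ _).trans (congrArg (ev i * ·) ?_)
    rw [← inner_conj_symm v, mul_comm, Complex.mul_conj, Complex.normSq_eq_norm_sq,
      Complex.ofReal_re]
  rw [hinner, ← b.sum_sq_norm_inner_right v, Finset.mul_sum, Finset.mul_sum]
  refine Finset.sum_le_sum fun i _ => ?_
  rw [← mul_assoc]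
  exact mul_le_mul_of_nonneg_right (hev_le i) (sq_nonneg _)

end LinearMap

namespace Representation

variable {G : Type*} [Group G]

/-- A lower bound on the degrees of nontrivial matrix representations bounds the dimension of every
nontrivial representation. -/
lemma le_finrank_of_exists_ne_one {V : Type*} [AddCommGroup V] [Module ℂ V]
    [FiniteDimensional ℂ V] {k : ℕ}
    (hrep : ∀ (d : ℕ) (ρ : G →* Matrix.GeneralLinearGroup (Fin d) ℂ), (∃ g, ρ g ≠ 1) → k ≤ d)
    (ρ : Representation ℂ G V) (hρ : ∃ g, ρ g ≠ 1) : k ≤ Module.finrank ℂ V := by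
  let e := LinearMap.toMatrixAlgEquiv (Module.finBasis ℂ V)
  let τ : G →* Matrix (Fin (Module.finrank ℂ V)) (Fin (Module.finrank ℂ V)) ℂ :=
    (e : _ →* _).comp ρ
  refine hrep _ τ.toHomUnits ?_
  obtain ⟨g, hg⟩ := hρ
  refine ⟨g, fun h => hg (e.injective ?_)⟩
  rw [map_one]
  exact congrArg Units.val h

/-- If an operator commutes with a representation and vanishes on its invariants, then its
eigenspaces for nonzero eigenvalues have large dimension. -/
lemma le_finrank_eigenspace {V : Type*} [AddCommGroup V] [Module ℂ V]
    [FiniteDimensional ℂ V] {k : ℕ}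
    (hrep : ∀ (d : ℕ) (ρ : G →* Matrix.GeneralLinearGroup (Fin d) ℂ), (∃ g, ρ g ≠ 1) → k ≤ d)
    (ρ : Representation ℂ G V) {T : Module.End ℂ V} (hT : ∀ g, Commute T (ρ g))
    (hinv : ∀ v ∈ ρ.invariants, T v = 0) {μ : ℂ} (hμ : μ ≠ 0) (hev : T.HasEigenvalue μ) :
    k ≤ Module.finrank ℂ (Module.End.eigenspace T μ) := by
  have hmaps (g : G) :
      Module.End.eigenspace T μ ≤ (Module.End.eigenspace T μ).comap (ρ g) :=
    Module.End.mapsTo_genEigenspace_of_comm (hT g) μ 1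
  refine le_finrank_of_exists_ne_one hrep (ρ.subrepresentation _ hmaps) ?_
  by_contra! htriv
  obtain ⟨v, hv, hv0⟩ := hev.exists_hasEigenvector
  have hfix : v ∈ ρ.invariants := fun g =>
    congrArg Subtype.val (LinearMap.congr_fun (htriv g) ⟨v, hv⟩)
  have h := Module.End.mem_eigenspace_iff.mp hv
  rw [hinv v hfix, eq_comm, smul_eq_zero] at h
  exact h.elim hμ hv0

/-- An operator commuting with a unitary representation and vanishing on its invariants has
operator norm at most its Hilbert-Schmidt norm divided by `√k`, where `k` bounds from below the
dimension of every nontrivial representation. -/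
lemma mul_norm_sq_le_sum_norm_sq {E : Type*} [NormedAddCommGroup E]
    [InnerProductSpace ℂ E] [FiniteDimensional ℂ E] {k : ℕ}
    (hrep : ∀ (d : ℕ) (ρ : G →* Matrix.GeneralLinearGroup (Fin d) ℂ), (∃ g, ρ g ≠ 1) → k ≤ d)
    (ρ : Representation ℂ G E) (hρ : ∀ g v w, ⟪ρ g v, ρ g w⟫_ℂ = ⟪v, w⟫_ℂ)
    {K : Module.End ℂ E} (hK : ∀ g, Commute K (ρ g)) (hinv : ∀ v ∈ ρ.invariants, K v = 0)
    {ι : Type*} [Fintype ι] (b : OrthonormalBasis ι ℂ E) (v : E) :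
    k * ‖K v‖ ^ 2 ≤ (∑ i, ‖K (b i)‖ ^ 2) * ‖v‖ ^ 2 := by
  have hinner (w : E) : (⟪w, (LinearMap.adjoint K * K) w⟫_ℂ).re = ‖K w‖ ^ 2 := by
    rw [Module.End.mul_apply, LinearMap.adjoint_inner_right]
    exact inner_self_eq_norm_sq (𝕜 := ℂ) _
  have htr : ((LinearMap.adjoint K * K).trace ℂ E).re = ∑ i, ‖K (b i)‖ ^ 2 := by
    rw [LinearMap.trace_eq_sum_inner _ b, Complex.re_sum]
    exact Finset.sum_congr rfl fun i _ => hinner _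
  have hcancel (g : G) (x : E) : ρ g (ρ g⁻¹ x) = x := by simp
  have hcomm (g : G) (x : E) : K (ρ g x) = ρ g (K x) := LinearMap.congr_fun (hK g) x
  have hadj (g : G) : Commute (LinearMap.adjoint K) (ρ g) := by
    refine LinearMap.ext fun x => ext_inner_right ℂ fun y => ?_
    rw [Module.End.mul_apply, Module.End.mul_apply, LinearMap.adjoint_inner_left,
      ← hcancel g (K y), hρ, ← hcomm, ← LinearMap.adjoint_inner_left, ← hρ g, hcancel]
  rw [← htr, ← hinner]
  refine LinearMap.IsPositive.mul_re_inner_le_re_trace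
    (LinearMap.isPositive_adjoint_comp_self K) (fun μ hμ hev => ?_) v
  refine le_finrank_eigenspace hrep ρ (fun g => (hadj g).mul_left (hK g)) (fun w hw => ?_) hμ hev
  rw [Module.End.mul_apply, hinv w hw, map_zero]

/-- The action of `G` by left translation on the Hilbert space of functions `G → ℂ`. -/
noncomputable def leftTranslation (G : Type*) [Group G] :
    Representation ℂ G (EuclideanSpace ℂ G) where
  toFun g :=
    { toFun := fun v => WithLp.toLp 2 fun x => v (g⁻¹ * x)
      map_add' := fun _ _ => rfl
      map_smul' := fun _ _ => rfl }
  map_one' := by ext; simp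
  map_mul' g h := by
    refine LinearMap.ext fun v => ?_
    ext x
    change v ((g * h)⁻¹ * x) = v (h⁻¹ * (g⁻¹ * x))
    rw [mul_inv_rev, mul_assoc]

@[simp]
lemma leftTranslation_apply (g : G) (v : EuclideanSpace ℂ G) (x : G) :
    leftTranslation G g v x = v (g⁻¹ * x) := rfl

lemma leftTranslation_inner [Fintype G] (g : G) (v w : EuclideanSpace ℂ G) :
    ⟪leftTranslation G g v, leftTranslation G g w⟫_ℂ = ⟪v, w⟫_ℂ := by
  simp only [PiLp.inner_apply, leftTranslation_apply]
  exact Equiv.sum_comp (Equiv.mulLeft g⁻¹) fun x => ⟪v x, w x⟫_ℂ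

end Representation

/-- Convolution with a function of mean zero on a quasirandom group has small operator norm. -/
lemma mul_sum_sq_convolution_le {G : Type*} [Group G] [Fintype G] {k : ℕ}
    (hrep : ∀ (d : ℕ) (ρ : G →* Matrix.GeneralLinearGroup (Fin d) ℂ), (∃ g, ρ g ≠ 1) → k ≤ d)
    (f g : G → ℝ) (hg : ∑ y, g y = 0) :
    k * ∑ x, (∑ y, g (x⁻¹ * y) * f y) ^ 2
      ≤ Fintype.card G * (∑ y, g y ^ 2) * ∑ y, f y ^ 2 := by
  classical
  let K : Module.End ℂ (EuclideanSpace ℂ G) :=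
    Matrix.toEuclideanLin (Matrix.of fun x y : G => (g (x⁻¹ * y) : ℂ))
  have hKapply (v : EuclideanSpace ℂ G) (x : G) : K v x = ∑ y, (g (x⁻¹ * y) : ℂ) * v y := rfl
  have hcomm (h : G) : Commute K (Representation.leftTranslation G h) := by
    refine LinearMap.ext fun v => ?_
    ext x
    simp only [Module.End.mul_apply, hKapply, Representation.leftTranslation_apply]
    exact Fintype.sum_equiv (Equiv.mulLeft h⁻¹) _ _ fun y => by simp [mul_assoc]
  have hinv : ∀ v ∈ (Representation.leftTranslation G).invariants, K v = 0 := by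
    intro v hv
    have hconst (y : G) : v y = v 1 := by
      have h := congrArg (fun w : EuclideanSpace ℂ G => w y) (hv y)
      simpa using h.symm
    ext x
    rw [hKapply]
    simp_rw [hconst, ← Finset.sum_mul]
    have hx : ∑ y, (g (x⁻¹ * y) : ℂ) = ∑ y, (g y : ℂ) :=
      Equiv.sum_comp (Equiv.mulLeft x⁻¹) fun y => (g y : ℂ)
    rw [hx, ← Complex.ofReal_sum, hg]
    simp
  have hbound := Representation.mul_norm_sq_le_sum_norm_sq hrep _
    Representation.leftTranslation_inner hcomm hinv (EuclideanSpace.basisFun G ℂ)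
    (WithLp.toLp 2 fun y => (f y : ℂ))
  have hKf : ‖K (WithLp.toLp 2 fun y => (f y : ℂ))‖ ^ 2
      = ∑ x, (∑ y, g (x⁻¹ * y) * f y) ^ 2 := by
    rw [EuclideanSpace.norm_sq_eq]
    refine Finset.sum_congr rfl fun x _ => ?_
    rw [hKapply]
    simp_rw [← Complex.ofReal_mul]
    rw [← Complex.ofReal_sum, Complex.norm_real, Real.norm_eq_abs, sq_abs]
  have hHS : ∑ z, ‖K (EuclideanSpace.basisFun G ℂ z)‖ ^ 2
      = Fintype.card G * ∑ y, g y ^ 2 := by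
    have hnorm (z : G) : ‖K (EuclideanSpace.basisFun G ℂ z)‖ ^ 2 = ∑ x, g (x⁻¹ * z) ^ 2 := by
      rw [EuclideanSpace.norm_sq_eq]
      refine Finset.sum_congr rfl fun x _ => ?_
      rw [hKapply]
      simp
    simp_rw [hnorm]
    rw [Finset.sum_comm]
    have hx (x : G) : ∑ z, g (x⁻¹ * z) ^ 2 = ∑ y, g y ^ 2 :=
      Equiv.sum_comp (Equiv.mulLeft x⁻¹) fun y => g y ^ 2
    simp [hx]
  have hf : ‖(WithLp.toLp 2 fun y => (f y : ℂ) : EuclideanSpace ℂ G)‖ ^ 2 = ∑ y, f y ^ 2 := by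
    simp [EuclideanSpace.norm_sq_eq]
  rwa [hKf, hHS, hf] at hbound

/-- A bound for the second moment of `|A ∩ xB|` about its mean `|A| |B| / |G|`. -/
lemma mul_sum_sq_card_inter_sub_le {G : Type*} [Group G] [Fintype G] [DecidableEq G] {k : ℕ}
    (hrep : ∀ (d : ℕ) (ρ : G →* Matrix.GeneralLinearGroup (Fin d) ℂ), (∃ g, ρ g ≠ 1) → k ≤ d)
    (A B : Finset G) :
    k * ∑ x : G, (((A ∩ B.image (fun b => x * b)).card : ℝ)
        - A.card * B.card / Fintype.card G) ^ 2
      ≤ Fintype.card G * B.card * A.card := by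
  have hn : (Fintype.card G : ℝ) ≠ 0 := Nat.cast_ne_zero.mpr Fintype.card_ne_zero
  set s : ℝ := B.card / Fintype.card G with hs
  let f : G → ℝ := fun y => if y ∈ A then 1 else 0
  let g : G → ℝ := fun y => (if y ∈ B then 1 else 0) - s
  have hfsum : ∑ y, f y = A.card := by simp [f]
  have hfsq : ∑ y, f y ^ 2 = A.card := by simp [f]
  have hBsum : ∑ y, (if y ∈ B then (1 : ℝ) else 0) = B.card := by simp
  have hg : ∑ y, g y = 0 := by
    simp only [g, Finset.sum_sub_distrib, hBsum, Finset.sum_const, Finset.card_univ,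
      nsmul_eq_mul, hs]
    field_simp
    ring
  have hgsq : ∑ y, g y ^ 2 ≤ B.card := by
    have hexpand (y : G) : g y ^ 2 = (if y ∈ B then 1 else 0) - 2 * s * g y - s ^ 2 := by
      simp only [g]
      split_ifs <;> ring
    simp_rw [hexpand, Finset.sum_sub_distrib, ← Finset.mul_sum, hg, hBsum]
    have : 0 ≤ ∑ _y : G, s ^ 2 := Finset.sum_nonneg fun _ _ => sq_nonneg s
    linarith
  have hconv (x : G) : ((A ∩ B.image (fun b => x * b)).card : ℝ)
      - A.card * B.card / Fintype.card G = ∑ y, g (x⁻¹ * y) * f y := by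
    have hset : A ∩ B.image (fun b => x * b) = A.filter fun y => x⁻¹ * y ∈ B := by
      ext y
      simp
    have hcard : ((A ∩ B.image (fun b => x * b)).card : ℝ)
        = ∑ y, (if x⁻¹ * y ∈ B then (1 : ℝ) else 0) * f y := by
      rw [hset, ← Finset.sum_boole]
      simp [f]
    simp only [g, sub_mul, Finset.sum_sub_distrib, ← Finset.mul_sum, hfsum, hcard, hs]
    ring
  simp_rw [hconv]
  refine (mul_sum_sq_convolution_le hrep f g hg).trans ?_
  rw [hfsq]
  gcongr


/-- Lemma 5.1 (Gowers, Quasirandom Groups): if every nontrivial complex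
representation of a finite group `G` of order `n` has dimension at least `k`,
`|A| = rn`, `|B| = sn`, and `r s t ≥ 1/(δ² k)`, then the number of `x ∈ G` with
`|A ∩ xB| ≤ (1 - δ) r s n` is at most `t n`. -/
theorem small_intersection_translates_rare
    (G : Type) [Group G] [Fintype G] [DecidableEq G] (k : ℕ) (hk0 : 0 < k)
    (hrep : ∀ (d : ℕ) (ρ : G →* Matrix.GeneralLinearGroup (Fin d) ℂ),
      (∃ g, ρ g ≠ 1) → k ≤ d)
    (A B : Finset G) (r s δ t : ℝ) (hδ : 0 < δ) (ht : 0 < t)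
    (hA : (A.card : ℝ) = r * Fintype.card G)
    (hB : (B.card : ℝ) = s * Fintype.card G)
    (hcond : 1 / (δ ^ 2 * (k : ℝ)) ≤ r * s * t) :
    ((Finset.univ.filter (fun x : G =>
        ((A ∩ B.image (fun b => x * b)).card : ℝ)
          ≤ (1 - δ) * r * s * Fintype.card G)).card : ℝ)
      ≤ t * Fintype.card G := by
  set n : ℝ := ((Fintype.card G : ℕ) : ℝ) with hn_def
  have hn : 0 < n := Nat.cast_pos.mpr Fintype.card_pos
  have hk : (0 : ℝ) < k := Nat.cast_pos.mpr hk0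
  have hrs : 0 < r * s := by
    have : 0 < r * s * t := lt_of_lt_of_le (by positivity) hcond
    exact pos_of_mul_pos_left this ht.le
  set X := Finset.univ.filter (fun x : G =>
    ((A ∩ B.image (fun b => x * b)).card : ℝ) ≤ (1 - δ) * r * s * n) with hX
  have hmoment := mul_sum_sq_card_inter_sub_le hrep A B
  rw [hA, hB, ← hn_def, show r * n * (s * n) / n = r * s * n by field_simp] at hmoment
  have hcheb : X.card * (δ * (r * s * n)) ^ 2
      ≤ ∑ x : G, (((A ∩ B.image (fun b => x * b)).card : ℝ) - r * s * n) ^ 2 := by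
    rw [← nsmul_eq_mul, ← Finset.sum_const]
    refine le_trans (Finset.sum_le_sum fun x hx => ?_)
      (Finset.sum_le_univ_sum_of_nonneg fun x => sq_nonneg _)
    have hx' := (Finset.mem_filter.mp hx).2
    rw [← neg_sq (_ - r * s * n)]
    exact pow_le_pow_left₀ (by positivity) (by linarith) 2
  have hcount : X.card * (k * δ ^ 2 * (r * s)) * (r * s * n ^ 2) ≤ n * (r * s * n ^ 2) := by
    have := mul_le_mul_of_nonneg_left hcheb hk.le
    linarith
  have hcount' := le_of_mul_le_mul_right hcount (by positivity)
  have hone : 1 ≤ t * (k * δ ^ 2 * (r * s)) := by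
    rw [div_le_iff₀ (by positivity)] at hcond
    linarith
  refine le_of_mul_le_mul_right (hcount'.trans ?_)
    (show 0 < k * δ ^ 2 * (r * s) by positivity)
  nlinarith
end

section
/- Let G be a finite group of order n such that every nontrivial complex representation of G has dimension at least k, let m ≥ 2, and for each nonempty subset F ⊆ {1, 2, …, m} let A_F be a subset of G of size p·n. Then, provided that p^{3·2^{m−2}} ≥ 2^{3m}/k (which holds in particular if p > 2·k^{−1/2^{2m}}), there exist elements x₁, …, x_m of G such that x_F ∈ A_F for every nonempty F ⊆ {1, …, m}, where x_F denotes the product of all x_i with i ∈ F, taken with the indices in increasing order. -/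
/-- A bound on the dimensions of matrix representations bounds the dimension of every nontrivial
representation on a finite-dimensional space. -/
lemma le_finrank_of_le_matrix_dim {G : Type} [Group G] {k : ℕ}
    (hrep : ∀ (d : ℕ) (ρ : G →* Matrix.GeneralLinearGroup (Fin d) ℂ),
      (∃ g, ρ g ≠ 1) → k ≤ d)
    {W : Type*} [AddCommGroup W] [Module ℂ W] [FiniteDimensional ℂ W]
    (φ : G →* Module.End ℂ W) (hφ : ∃ g, φ g ≠ 1) : k ≤ Module.finrank ℂ W := by
  let e := LinearMap.toMatrixAlgEquiv (Module.finBasis ℂ W)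
  let ψ : G →* Matrix (Fin (Module.finrank ℂ W)) (Fin (Module.finrank ℂ W)) ℂ :=
    (e : Module.End ℂ W →* Matrix _ _ ℂ).comp φ
  obtain ⟨g, hg⟩ := hφ
  refine hrep _ ψ.toHomUnits ⟨g, fun h => hg (e.injective ?_)⟩
  have := congrArg Units.val h
  simpa [ψ] using this

section Convolution

variable {G : Type} [Group G]

/-- The left regular representation on functions `G → ℂ`. -/
noncomputable def leftTranslation : G →* Module.End ℂ (EuclideanSpace ℂ G) where
  toFun g :=
    { toFun := fun v => WithLp.toLp 2 fun y => v (g⁻¹ * y)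
      map_add' := fun v w => by ext; simp
      map_smul' := fun c v => by ext; simp }
  map_one' := by ext; simp
  map_mul' g h := by ext; simp [mul_assoc]

@[simp]
lemma leftTranslation_apply (g : G) (v : EuclideanSpace ℂ G) (y : G) :
    leftTranslation g v y = v (g⁻¹ * y) := rfl

variable [Fintype G]

/-- The operator `v ↦ (x ↦ ∑ y, f (x * y) * v y)` on functions `G → ℂ`. -/
noncomputable def correlation (f : G → ℂ) :
    EuclideanSpace ℂ G →ₗ[ℂ] EuclideanSpace ℂ G where
  toFun v := WithLp.toLp 2 fun x => ∑ y, f (x * y) * v y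
  map_add' v w := by ext; simp [mul_add, Finset.sum_add_distrib]
  map_smul' c v := by ext; simp [Finset.mul_sum, mul_left_comm]

@[simp]
lemma correlation_apply (f : G → ℂ) (v : EuclideanSpace ℂ G) (x : G) :
    correlation f v x = ∑ y, f (x * y) * v y := rfl

lemma inner_correlation_leftTranslation (f : G → ℂ) (g : G) (v w : EuclideanSpace ℂ G) :
    inner ℂ (correlation f v) (correlation f (leftTranslation g w)) =
      inner ℂ (correlation f (leftTranslation g⁻¹ v)) (correlation f w) := by
  have key (u : EuclideanSpace ℂ G) (h x : G) :
      correlation f (leftTranslation h u) x = correlation f u (x * h) := by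
    simp only [correlation_apply, leftTranslation_apply]
    refine Fintype.sum_equiv (Equiv.mulLeft h⁻¹) _ _ fun y => ?_
    simp [mul_assoc]
  simp only [PiLp.inner_apply, key]
  refine Fintype.sum_equiv (Equiv.mulRight g) _ _ fun y => ?_
  simp

lemma inner_leftTranslation (g : G) (v w : EuclideanSpace ℂ G) :
    inner ℂ v (leftTranslation g w) = inner ℂ (leftTranslation g⁻¹ v) w := by
  simp only [PiLp.inner_apply, leftTranslation_apply]
  refine Fintype.sum_equiv (Equiv.mulLeft g⁻¹) _ _ fun y => ?_
  simp

lemma leftTranslation_commute (f : G → ℂ) (g : G) (v : EuclideanSpace ℂ G) :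
    ((correlation f).adjoint * correlation f) (leftTranslation g v) =
      leftTranslation g (((correlation f).adjoint * correlation f) v) := by
  refine ext_inner_left ℂ fun u => ?_
  rw [inner_leftTranslation]
  simp only [Module.End.mul_apply, LinearMap.adjoint_inner_right]
  exact inner_correlation_leftTranslation f g u v

lemma correlation_eq_zero_of_invariant {f : G → ℂ} (hf : ∑ x, f x = 0)
    {v : EuclideanSpace ℂ G} (hv : ∀ g, leftTranslation g v = v) : correlation f v = 0 := by
  ext x
  have hc (y : G) : v y = v 1 := by
    have := congrArg (fun u : EuclideanSpace ℂ G => u y) (hv y)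
    simpa using this.symm
  have hs : ∑ y, f (x * y) = 0 := by
    rw [← hf]
    exact Fintype.sum_equiv (Equiv.mulLeft x) _ _ fun y => rfl
  simp only [correlation_apply, hc, ← Finset.sum_mul, hs]
  simp

lemma sum_norm_sq_correlation {ι : Type*} [Fintype ι] (f : G → ℂ)
    (b : OrthonormalBasis ι ℂ (EuclideanSpace ℂ G)) :
    ∑ i, ‖correlation f (b i)‖ ^ 2 = Fintype.card G * ∑ x, ‖f x‖ ^ 2 := by
  let r (x : G) : EuclideanSpace ℂ G := WithLp.toLp 2 fun y => star (f (x * y))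
  have hr (x : G) (v : EuclideanSpace ℂ G) : correlation f v x = inner ℂ (r x) v := by
    simp [r, PiLp.inner_apply, mul_comm]
  have hn (x : G) : ‖r x‖ ^ 2 = ∑ y, ‖f y‖ ^ 2 := by
    rw [EuclideanSpace.norm_sq_eq]
    exact Fintype.sum_equiv (Equiv.mulLeft x) _ _ fun y => by simp [r]
  simp_rw [EuclideanSpace.norm_sq_eq, hr]
  rw [Finset.sum_comm]
  simp_rw [b.sum_sq_norm_inner_left, hn]
  simp

/-- The quasirandomness inequality: a mean-zero kernel has small operator norm when all nontrivial
representations have large dimension. -/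
lemma norm_sq_correlation_le {k : ℕ}
    (hrep : ∀ (d : ℕ) (ρ : G →* Matrix.GeneralLinearGroup (Fin d) ℂ),
      (∃ g, ρ g ≠ 1) → k ≤ d)
    {f : G → ℂ} (hf : ∑ x, f x = 0) (v : EuclideanSpace ℂ G) :
    k * ‖correlation f v‖ ^ 2 ≤ (Fintype.card G * ∑ x, ‖f x‖ ^ 2) * ‖v‖ ^ 2 := by
  set T := correlation f
  have hsymm : (T.adjoint * T).IsSymmetric := LinearMap.isSymmetric_adjoint_mul_self T
  let b := hsymm.eigenvectorBasis rfl
  let μ := hsymm.eigenvalues rfl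
  have hb (i) : (T.adjoint * T) (b i) = (μ i : ℂ) • b i := hsymm.apply_eigenvectorBasis rfl i
  have hTb (i) : ‖T (b i)‖ ^ 2 = μ i := by
    have h : inner ℂ (b i) ((T.adjoint * T) (b i)) = (μ i : ℂ) := by
      rw [hb, inner_smul_right, inner_self_eq_norm_sq_to_K]
      simp
    rw [Module.End.mul_apply, LinearMap.adjoint_inner_right, inner_self_eq_norm_sq_to_K] at h
    exact Complex.ofReal_injective (by push_cast; exact h)
  have hμ (j) : k * μ j ≤ Fintype.card G * ∑ x, ‖f x‖ ^ 2 := by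
    have hsum := sum_norm_sq_correlation f b
    rcases eq_or_ne (μ j) 0 with h0 | h0
    · rw [h0, mul_zero]
      positivity
    let W := Module.End.eigenspace (T.adjoint * T) (μ j : ℂ)
    have hinv (g : G) : ∀ w ∈ W, leftTranslation g w ∈ W := fun w hw => by
      rw [Module.End.mem_eigenspace_iff] at hw ⊢
      rw [leftTranslation_commute, hw, map_smul]
    let φ : G →* Module.End ℂ W :=
      { toFun := fun g => (leftTranslation g).restrict (hinv g)
        map_one' := by ext; simp
        map_mul' := fun g h => by ext; simp }
    have hk : k ≤ Module.finrank ℂ W := by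
      refine le_finrank_of_le_matrix_dim hrep φ ?_
      by_contra! hφ
      have hT : T (b j) = 0 := correlation_eq_zero_of_invariant hf fun g => by
        have := congrArg Subtype.val
          (LinearMap.congr_fun (hφ g) ⟨b j, Module.End.mem_eigenspace_iff.2 (hb j)⟩)
        simpa [φ] using this
      exact h0 (by rw [← hTb, hT]; simp)
    have hcard := hsymm.card_filter_eigenvalues_eq rfl (μ j : ℂ)
    calc (k : ℝ) * μ j ≤ Module.finrank ℂ W * μ j :=
          mul_le_mul_of_nonneg_right (by exact_mod_cast hk) (hTb j ▸ by positivity)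
      _ = ∑ i with ((μ i : ℂ) = μ j), ‖T (b i)‖ ^ 2 := by
          rw [← hcard, ← nsmul_eq_mul, ← Finset.sum_const]
          refine Finset.sum_congr rfl fun i hi => ?_
          rw [hTb]
          exact_mod_cast (Finset.mem_filter.1 hi).2.symm
      _ ≤ ∑ i, ‖T (b i)‖ ^ 2 :=
          Finset.sum_le_sum_of_subset_of_nonneg (Finset.filter_subset _ _)
            fun _ _ _ => by positivity
      _ = _ := hsum
  have hTv : ‖T v‖ ^ 2 = ∑ i, μ i * ‖inner ℂ (b i) v‖ ^ 2 := by
    have h : inner ℂ v ((T.adjoint * T) v) = ∑ i, (μ i * ‖inner ℂ (b i) v‖ ^ 2 : ℂ) := by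
      rw [← b.sum_inner_mul_inner]
      refine Finset.sum_congr rfl fun i _ => ?_
      rw [← hsymm, hb, inner_smul_left, ← inner_conj_symm v (b i)]
      have := Complex.conj_mul' (inner ℂ (b i) v)
      rw [← this]
      simp
      ring
    rw [Module.End.mul_apply, LinearMap.adjoint_inner_right, inner_self_eq_norm_sq_to_K] at h
    exact Complex.ofReal_injective (by push_cast; exact h)
  rw [hTv, ← b.sum_sq_norm_inner_right v, Finset.mul_sum, Finset.mul_sum]
  refine Finset.sum_le_sum fun i _ => ?_
  rw [← mul_assoc]
  exact mul_le_mul_of_nonneg_right (hμ i) (by positivity)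

end Convolution

section Counting

variable {G : Type} [Group G] [Fintype G] [DecidableEq G]

lemma sum_sq_card_filter_sub_le {k : ℕ}
    (hrep : ∀ (d : ℕ) (ρ : G →* Matrix.GeneralLinearGroup (Fin d) ℂ),
      (∃ g, ρ g ≠ 1) → k ≤ d) (A B : Finset G) :
    (k : ℝ) * ∑ x : G, (({y ∈ A | x * y ∈ B}.card : ℝ) -
      A.card * B.card / Fintype.card G) ^ 2 ≤ Fintype.card G * B.card * A.card := by
  have hn : (Fintype.card G : ℝ) ≠ 0 := by exact_mod_cast Fintype.card_ne_zero
  let f (x : G) : ℝ := (if x ∈ B then 1 else 0) - B.card / Fintype.card G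
  let v : EuclideanSpace ℂ G := WithLp.toLp 2 fun y => if y ∈ A then 1 else 0
  have hf : ∑ x, f x = 0 := by
    simp only [f, Finset.sum_sub_distrib, Finset.sum_ite_mem, Finset.univ_inter,
      Finset.sum_const, Finset.card_univ, nsmul_eq_mul]
    field_simp
    simp
  have hf2 : ∑ x, ‖(f x : ℂ)‖ ^ 2 ≤ B.card := by
    have h : ∀ x, ‖(f x : ℂ)‖ ^ 2 =
        (if x ∈ B then 1 else 0) - B.card / Fintype.card G * ((if x ∈ B then 1 else 0) + f x) := by
      intro x
      rw [Complex.norm_real, Real.norm_eq_abs, sq_abs]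
      by_cases hx : x ∈ B <;> simp [f, hx] <;> ring
    simp_rw [h]
    rw [Finset.sum_sub_distrib, ← Finset.mul_sum, Finset.sum_add_distrib, hf]
    simp only [Finset.sum_ite_mem, Finset.univ_inter, Finset.sum_const, nsmul_eq_mul, mul_one,
      add_zero]
    have : (0 : ℝ) ≤ B.card / Fintype.card G * B.card := by positivity
    linarith
  have hv : ‖v‖ ^ 2 = A.card := by
    rw [EuclideanSpace.norm_sq_eq]
    simp [v, apply_ite]
  have hT : ‖correlation (fun x => (f x : ℂ)) v‖ ^ 2 = ∑ x : G,
      (({y ∈ A | x * y ∈ B}.card : ℝ) - A.card * B.card / Fintype.card G) ^ 2 := by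
    rw [EuclideanSpace.norm_sq_eq]
    refine Finset.sum_congr rfl fun x _ => ?_
    have h : correlation (fun x => (f x : ℂ)) v x =
        (((({y ∈ A | x * y ∈ B}.card : ℝ) - A.card * B.card / Fintype.card G : ℝ)) : ℂ) := by
      simp only [correlation_apply, v, mul_ite, mul_one, mul_zero, Finset.sum_ite_mem,
        Finset.univ_inter]
      rw [← Complex.ofReal_sum]
      congr 1
      simp only [f, Finset.sum_sub_distrib, Finset.sum_const, nsmul_eq_mul, Finset.sum_boole]
      ring
    rw [h, Complex.norm_real, Real.norm_eq_abs, sq_abs]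
  have := norm_sq_correlation_le hrep (f := fun x => (f x : ℂ)) (by exact_mod_cast hf) v
  rw [hT, hv] at this
  refine this.trans ?_
  gcongr

lemma card_small_intersection_le {k : ℕ}
    (hrep : ∀ (d : ℕ) (ρ : G →* Matrix.GeneralLinearGroup (Fin d) ℂ),
      (∃ g, ρ g ≠ 1) → k ≤ d) {A B : Finset G} {p δ : ℝ} (hp : 0 < p) (hδ : 0 ≤ δ)
    (hδ1 : δ ≤ 1) (hA : p * Fintype.card G ≤ A.card) (hB : p * Fintype.card G ≤ B.card) :
    ((Finset.univ.filter fun x : G =>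
      ({y ∈ A | x * y ∈ B}.card : ℝ) < p ^ 2 * (1 - δ) * Fintype.card G).card : ℝ) *
      (k * δ ^ 2 * p ^ 2) ≤ Fintype.card G := by
  have hn : (0 : ℝ) < Fintype.card G := by exact_mod_cast Fintype.card_pos
  set n : ℝ := (Fintype.card G : ℝ) with hn_def
  set a : ℝ := (A.card : ℝ) with ha_def
  set b : ℝ := (B.card : ℝ) with hb_def
  set S : Finset G := {x : G | ({y ∈ A | x * y ∈ B}.card : ℝ) < p ^ 2 * (1 - δ) * n}
  have ha : 0 < a := lt_of_lt_of_le (by positivity) hA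
  have hb : 0 < b := lt_of_lt_of_le (by positivity) hB
  have hab : p ^ 2 * n ^ 2 ≤ a * b := by
    calc p ^ 2 * n ^ 2 = (p * n) * (p * n) := by ring
      _ ≤ a * b := by gcongr
  have hab' : p ^ 2 * n ≤ a * b / n := by
    rw [le_div_iff₀ hn]
    linarith
  have hS : S.card * (δ * (a * b / n)) ^ 2 ≤ ∑ x : G,
      (({y ∈ A | x * y ∈ B}.card : ℝ) - a * b / n) ^ 2 := by
    rw [← nsmul_eq_mul, ← Finset.sum_const]
    refine (Finset.sum_le_sum fun x hx => ?_).trans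
      (Finset.sum_le_sum_of_subset_of_nonneg (Finset.subset_univ S) fun _ _ _ => sq_nonneg _)
    have hx' := (Finset.mem_filter.1 hx).2
    have h1 : p ^ 2 * n * (1 - δ) ≤ a * b / n * (1 - δ) :=
      mul_le_mul_of_nonneg_right hab' (by linarith)
    rw [← neg_sq (_ - _)]
    exact pow_le_pow_left₀ (by positivity) (by linarith) 2
  have hvar := sum_sq_card_filter_sub_le hrep A B
  have hmul : k * (S.card * (δ * (a * b / n)) ^ 2) ≤ n * b * a :=
    (mul_le_mul_of_nonneg_left hS (Nat.cast_nonneg k)).trans hvar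
  have h2 : S.card * (k * δ ^ 2) * (a * b) ≤ n * n ^ 2 := by
    have : k * (S.card * (δ * (a * b / n)) ^ 2) =
        S.card * (k * δ ^ 2) * (a * b) * (a * b) / n ^ 2 := by
      field_simp
    rw [this, div_le_iff₀ (by positivity)] at hmul
    exact le_of_mul_le_mul_right (by linarith) (mul_pos ha hb)
  have h3 : S.card * (k * δ ^ 2) * (p ^ 2 * n ^ 2) ≤ S.card * (k * δ ^ 2) * (a * b) := by
    gcongr
  exact le_of_mul_le_mul_right (a := n ^ 2) (by linarith) (by positivity)

/-- Some element of `C` translates all pairs `(A i, B i)` into position with large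
intersection. -/
lemma exists_mem_large_intersections {k : ℕ}
    (hrep : ∀ (d : ℕ) (ρ : G →* Matrix.GeneralLinearGroup (Fin d) ℂ),
      (∃ g, ρ g ≠ 1) → k ≤ d) {ι : Type*} (s : Finset ι) {A B : ι → Finset G} {C : Finset G}
    {p δ : ℝ} (hp : 0 < p) (hδ : 0 < δ) (hδ1 : δ ≤ 1) (hC : p * Fintype.card G ≤ C.card)
    (hA : ∀ i ∈ s, p * Fintype.card G ≤ (A i).card)
    (hB : ∀ i ∈ s, p * Fintype.card G ≤ (B i).card) (hs : s.card < k * δ ^ 2 * p ^ 3) :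
    ∃ x ∈ C, ∀ i ∈ s,
      p ^ 2 * (1 - δ) * Fintype.card G ≤ ({y ∈ A i | x * y ∈ B i}.card : ℝ) := by
  by_contra! hcon
  have hn : (0 : ℝ) < Fintype.card G := by exact_mod_cast Fintype.card_pos
  let S (i : ι) : Finset G :=
    {x : G | ({y ∈ A i | x * y ∈ B i}.card : ℝ) < p ^ 2 * (1 - δ) * Fintype.card G}
  have hsub : C ⊆ s.biUnion S := fun x hx => by
    obtain ⟨i, hi, h⟩ := hcon x hx
    exact Finset.mem_biUnion.2 ⟨i, hi, Finset.mem_filter.2 ⟨Finset.mem_univ x, h⟩⟩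
  have hcard : (C.card : ℝ) ≤ ∑ i ∈ s, ((S i).card : ℝ) := by
    exact_mod_cast (Finset.card_le_card hsub).trans Finset.card_biUnion_le
  have hk : 0 ≤ k * δ ^ 2 * p ^ 2 := by positivity
  have h1 : (∑ i ∈ s, ((S i).card : ℝ)) * (k * δ ^ 2 * p ^ 2) ≤ s.card * Fintype.card G := by
    rw [Finset.sum_mul, ← nsmul_eq_mul s.card]
    exact Finset.sum_le_card_nsmul _ _ _ fun i hi =>
      card_small_intersection_le hrep hp hδ.le hδ1 (hA i hi) (hB i hi)
  have h2 := mul_le_mul_of_nonneg_right (hC.trans hcard) hk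
  have h3 := mul_lt_mul_of_pos_right hs hn
  linarith

end Counting

lemma sort_map_succ {m : ℕ} (F : Finset (Fin m)) :
    (F.map (Fin.succEmb m)).sort (· ≤ ·) = (F.sort (· ≤ ·)).map Fin.succ :=
  (Finset.map_sort (f := Fin.succEmb m) (s := F) (r := (· ≤ ·)) (r' := (· ≤ ·))
    fun _ _ _ _ => (Fin.succ_le_succ_iff).symm).symm

lemma sort_insert_zero_map_succ {m : ℕ} (F : Finset (Fin m)) :
    (insert 0 (F.map (Fin.succEmb m))).sort (· ≤ ·) = 0 :: (F.sort (· ≤ ·)).map Fin.succ := by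
  rw [Finset.sort_insert _ (fun b _ => Fin.zero_le b) (by simp), sort_map_succ]

lemma eq_map_succ_or_eq_insert_zero {m : ℕ} (F : Finset (Fin (m + 1))) :
    ∃ F' : Finset (Fin m),
      F = F'.map (Fin.succEmb m) ∨ F = insert 0 (F'.map (Fin.succEmb m)) := by
  refine ⟨Finset.univ.filter fun i => i.succ ∈ F, ?_⟩
  by_cases h : 0 ∈ F
  · right
    ext i
    refine Fin.cases ?_ (fun j => ?_) i <;> simp [h]
  · left
    ext i
    refine Fin.cases ?_ (fun j => ?_) i <;> simp [h]

lemma density_bound_step {k p : ℝ} {m : ℕ} (hp : 0 < p) (hp1 : p ≤ 1) (hk : 0 ≤ k)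
    (h : (2 : ℝ) ^ (3 * (m + 2)) ≤ k * p ^ (3 * 2 ^ m)) :
    ((2 : ℝ) ^ (m + 1) < k * (1 / 2 ^ (m + 1)) ^ 2 * p ^ 3) ∧
      (1 ≤ m → (2 : ℝ) ^ (3 * (m + 1)) ≤
        k * (p ^ 2 * (1 - 1 / 2 ^ (m + 1))) ^ (3 * 2 ^ (m - 1))) := by
  constructor
  · have h1 : p ^ (3 * 2 ^ m) ≤ p ^ 3 :=
      pow_le_pow_of_le_one hp.le hp1 (Nat.le_mul_of_pos_right 3 (by positivity))
    have h2 := h.trans (mul_le_mul_of_nonneg_left h1 hk)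
    have e : k * (1 / 2 ^ (m + 1)) ^ 2 * p ^ 3 = k * p ^ 3 / (2 ^ (m + 1)) ^ 2 := by
      field_simp
    rw [e, lt_div_iff₀ (by positivity)]
    refine lt_of_lt_of_le ?_ h2
    rw [← pow_mul, ← pow_add]
    exact pow_lt_pow_right₀ (by norm_num) (by omega)
  · intro hm
    obtain ⟨j, rfl⟩ : ∃ j, m = j + 1 := ⟨m - 1, by omega⟩
    have hb : (1 : ℝ) / 4 ≤ (1 - 1 / 2 ^ (j + 1 + 1)) ^ (3 * 2 ^ j) := by
      have hle : (1 : ℝ) / 2 ^ (j + 1 + 1) ≤ 1 := by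
        rw [div_le_one (by positivity)]
        exact one_le_pow₀ (by norm_num)
      have := one_add_mul_le_pow (a := -((1 : ℝ) / 2 ^ (j + 1 + 1))) (by linarith) (3 * 2 ^ j)
      rw [← sub_eq_add_neg 1] at this
      refine le_trans (le_of_eq ?_) this
      push_cast
      field_simp
      ring
    have e : k * (p ^ 2 * (1 - 1 / 2 ^ (j + 1 + 1))) ^ (3 * 2 ^ (j + 1 - 1)) =
        k * p ^ (3 * 2 ^ (j + 1)) * (1 - 1 / 2 ^ (j + 1 + 1)) ^ (3 * 2 ^ j) := by
      rw [mul_pow, ← pow_mul, Nat.add_sub_cancel, show 2 * (3 * 2 ^ j) = 3 * 2 ^ (j + 1) by ring]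
      ring
    rw [e]
    calc (2 : ℝ) ^ (3 * (j + 1 + 1)) ≤ 2 ^ (3 * (j + 1 + 2)) * (1 / 4) := by
          rw [show 3 * (j + 1 + 2) = 3 * (j + 1 + 1) + 3 by ring, pow_add]
          have : (0 : ℝ) < 2 ^ (3 * (j + 1 + 1)) := by positivity
          linarith
      _ ≤ _ := mul_le_mul h hb (by norm_num) ((by positivity : (0 : ℝ) ≤ _).trans h)

lemma exists_products_mem {G : Type} [Group G] [Fintype G] {k : ℕ}
    (hrep : ∀ (d : ℕ) (ρ : G →* Matrix.GeneralLinearGroup (Fin d) ℂ),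
      (∃ g, ρ g ≠ 1) → k ≤ d)
    (m : ℕ) (A : Finset (Fin (m + 1)) → Finset G) (p : ℝ) (hp : 0 < p)
    (hA : ∀ F : Finset (Fin (m + 1)), F.Nonempty → p * Fintype.card G ≤ (A F).card)
    (hkp : 1 ≤ m → (2 : ℝ) ^ (3 * (m + 1)) ≤ k * p ^ (3 * 2 ^ (m - 1))) :
    ∃ x : Fin (m + 1) → G, ∀ F : Finset (Fin (m + 1)), F.Nonempty →
      ((F.sort (· ≤ ·)).map x).prod ∈ A F := by
  classical
  have hn : (0 : ℝ) < Fintype.card G := by exact_mod_cast Fintype.card_pos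
  induction m generalizing p with
  | zero =>
    have h := hA {0} (by simp)
    have hpos : (0 : ℝ) < (A {0}).card := lt_of_lt_of_le (by positivity) h
    obtain ⟨g, hg⟩ := Finset.card_pos.1 (by exact_mod_cast hpos)
    refine ⟨fun _ => g, fun F hF => ?_⟩
    obtain rfl : F = {0} := by
      rw [Finset.eq_singleton_iff_nonempty_unique_mem]
      exact ⟨hF, fun x _ => Subsingleton.elim (α := Fin 1) _ _⟩
    simpa using hg
  | succ m ih =>
    have hp1 : p ≤ 1 := by
      have h := hA {0} (by simp)
      have h' : ((A {0}).card : ℝ) ≤ Fintype.card G := by exact_mod_cast Finset.card_le_univ _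
      exact le_of_mul_le_mul_right (by linarith) hn
    obtain ⟨hs, hnext⟩ := density_bound_step hp hp1 (Nat.cast_nonneg k) (hkp (by omega))
    have hδ : (1 : ℝ) / 2 ^ (m + 1) < 1 := by
      rw [div_lt_one (by positivity)]
      exact one_lt_pow₀ (by norm_num) (by omega)
    obtain ⟨g, hg, hgF⟩ := exists_mem_large_intersections hrep
      (s := (Finset.univ : Finset (Finset (Fin (m + 1)))).filter Finset.Nonempty)
      (A := fun F => A (F.map (Fin.succEmb _)))
      (B := fun F => A (insert 0 (F.map (Fin.succEmb _))))
      (C := A {0}) (δ := 1 / 2 ^ (m + 1)) hp (by positivity) hδ.le (hA _ (by simp))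
      (fun F hF => hA _ (by simpa using hF)) (fun F _ => hA _ (by simp)) (by
        refine lt_of_le_of_lt ?_ hs
        have := Finset.card_filter_le (Finset.univ : Finset (Finset (Fin (m + 1))))
          Finset.Nonempty
        rw [Finset.card_univ, Fintype.card_finset, Fintype.card_fin] at this
        exact_mod_cast this)
    obtain ⟨x, hx⟩ := ih
      (fun F => {y ∈ A (F.map (Fin.succEmb _)) | g * y ∈ A (insert 0 (F.map (Fin.succEmb _)))})
      (p ^ 2 * (1 - 1 / 2 ^ (m + 1))) (mul_pos (by positivity) (by linarith))
      (fun F hF => hgF F (by simpa using hF)) hnext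
    refine ⟨Fin.cons g x, fun F hF => ?_⟩
    obtain ⟨F', rfl | rfl⟩ := eq_map_succ_or_eq_insert_zero F
    · rw [sort_map_succ, List.map_map]
      exact (Finset.mem_filter.1 (hx F' (by simpa using hF))).1
    · rw [sort_insert_zero_map_succ, List.map_cons, List.map_map, List.prod_cons]
      rcases F'.eq_empty_or_nonempty with rfl | hF'
      · simpa using hg
      · exact (Finset.mem_filter.1 (hx F' hF')).2

/-- Corollary 5.4 (Gowers, Quasirandom Groups): if every nontrivial complex
representation of a finite group `G` of order `n` has dimension at least `k`,
`m ≥ 2`, and for every nonempty `F ⊆ {1,…,m}` the set `A_F ⊆ G` has density `p`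
with `p^{3·2^{m−2}} ≥ 2^{3m}/k`, then there exist `x₁, …, x_m ∈ G` with the
increasing-order product `x_F ∈ A_F` for every nonempty `F`. -/
theorem simultaneous_products_equal_densities
    (G : Type) [Group G] [Fintype G] (k : ℕ) (hk0 : 0 < k)
    (hrep : ∀ (d : ℕ) (ρ : G →* Matrix.GeneralLinearGroup (Fin d) ℂ),
      (∃ g, ρ g ≠ 1) → k ≤ d)
    (m : ℕ) (hm : 2 ≤ m) (A : Finset (Fin m) → Finset G) (p : ℝ)
    (hA : ∀ F : Finset (Fin m), F.Nonempty →
      ((A F).card : ℝ) = p * Fintype.card G)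
    (hp : (2 : ℝ) ^ (3 * m) / (k : ℝ) ≤ p ^ (3 * 2 ^ (m - 2))) :
    ∃ x : Fin m → G, ∀ F : Finset (Fin m), F.Nonempty →
      ((F.sort (· ≤ ·)).map x).prod ∈ A F := by
  have hn : (0 : ℝ) < Fintype.card G := by exact_mod_cast Fintype.card_pos
  have hk : (0 : ℝ) < k := by exact_mod_cast hk0
  obtain ⟨m, rfl⟩ : ∃ j, m = j + 2 := ⟨m - 2, by omega⟩
  rw [Nat.add_sub_cancel] at hp
  have hp0 : 0 ≤ p := by
    have h : 0 ≤ p * Fintype.card G := hA {0} (by simp) ▸ Nat.cast_nonneg _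
    exact nonneg_of_mul_nonneg_left h hn
  have hpos : 0 < p := by
    refine hp0.lt_of_ne' fun h => ?_
    rw [h, zero_pow (by positivity)] at hp
    exact absurd hp (not_le.2 (by positivity))
  refine exists_products_mem hrep (m + 1) A p hpos (fun F hF => (hA F hF).ge) fun _ => ?_
  rw [div_le_iff₀ hk] at hp
  rw [mul_comm (k : ℝ)]
  exact hp
end

section
/- Let G be a finite group of order n such that every nontrivial complex representation of G has dimension at least k, let m ≥ 2, and for every pair 1 ≤ i < j ≤ m let A_{ij} be a subset of G of size p·n. Then, provided that p^{2m−3} ≥ 2^{3m}/k, there exist elements x₁, …, x_m of G such that x_i·x_j ∈ A_{ij} for every pair i < j. -/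
open scoped ComplexOrder in
open Finset in
/-- The multiplicity of an eigenvalue of a positive semidefinite matrix times that eigenvalue is at
most the trace. -/
theorem Matrix.PosSemidef.finrank_eigenspace_mul_le_trace {ι : Type*} [Fintype ι] [DecidableEq ι]
    {N : Matrix ι ι ℂ} (hN : N.PosSemidef) (c : ℝ) :
    Module.finrank ℂ (Module.End.eigenspace (Matrix.toLin' N) (c : ℂ)) * c ≤ N.trace.re := by
  have htr : N.trace.re = ∑ i, hN.1.eigenvalues i := by
    rw [hN.1.trace_eq_sum_eigenvalues]; simp
  rw [htr]
  rcases lt_or_ge c 0 with hc | hc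
  · exact (mul_nonpos_of_nonneg_of_nonpos (by positivity) hc.le).trans
      (sum_nonneg fun i _ => hN.eigenvalues_nonneg i)
  have hcard : Module.finrank ℂ (Module.End.eigenspace (Matrix.toLin' N) (c : ℂ)) ≤
      #{i | hN.1.eigenvalues i = c} := by
    refine (LinearMap.finrank_eigenspace_le _ _).trans ?_
    rw [Matrix.charpoly_toLin', ← Polynomial.count_roots, hN.1.roots_charpoly_eq_eigenvalues,
      Multiset.count_map, Finset.card, Finset.filter_val]
    refine Multiset.card_le_card (Multiset.monotone_filter_right _ fun i hi => ?_)
    simpa using hi.symm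
  calc _ ≤ (#{i | hN.1.eigenvalues i = c} : ℝ) * c := by gcongr
    _ = ∑ i with hN.1.eigenvalues i = c, hN.1.eigenvalues i := by
      rw [sum_congr rfl (fun i hi => (mem_filter.1 hi).2)]; simp
    _ ≤ _ := sum_le_sum_of_subset_of_nonneg (filter_subset _ _)
      fun i _ _ => hN.eigenvalues_nonneg i

open scoped ComplexOrder in
/-- If all eigenvalues of a Hermitian matrix `N` are at most `L`, then `L • 1 - N` is positive
semidefinite. -/
theorem Matrix.IsHermitian.posSemidef_smul_one_sub {ι : Type*} [Fintype ι] [DecidableEq ι]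
    {N : Matrix ι ι ℂ} (hN : N.IsHermitian) (L : ℝ)
    (h : ∀ (c : ℝ) (v : ι → ℂ), v ≠ 0 → N.mulVec v = (c : ℂ) • v → c ≤ L) :
    ((L : ℂ) • (1 : Matrix ι ι ℂ) - N).PosSemidef := by
  have hH : ((L : ℂ) • (1 : Matrix ι ι ℂ) - N).IsHermitian := by
    refine Matrix.IsHermitian.sub ?_ hN
    rw [Matrix.IsHermitian, Matrix.conjTranspose_smul]; simp
  rw [hH.posSemidef_iff_eigenvalues_nonneg]
  intro i
  have h1 := hH.mulVec_eigenvectorBasis i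
  have h2 := h (L - hH.eigenvalues i) (hH.eigenvectorBasis i).ofLp ?_ ?_
  · simpa using h2
  · simpa using hH.eigenvectorBasis.orthonormal.ne_zero i
  · rw [Matrix.sub_mulVec, Matrix.smul_mulVec, Matrix.one_mulVec] at h1
    rw [← sub_sub_cancel ((L : ℂ) • (hH.eigenvectorBasis i).ofLp) (N.mulVec _), h1]
    ext j
    simp [sub_mul]

/-- Left translation on functions, as an action by linear endomorphisms of an invariant
submodule. -/
noncomputable def translationOn {G : Type*} [Group G] (E : Submodule ℂ (G → ℂ))
    (hE : ∀ g : G, ∀ f ∈ E, (fun x => f (g⁻¹ * x)) ∈ E) : G →* Module.End ℂ E where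
  toFun g :=
    { toFun := fun f => ⟨fun x => f.1 (g⁻¹ * x), hE g f.1 f.2⟩
      map_add' := fun _ _ => rfl
      map_smul' := fun _ _ => rfl }
  map_one' := by ext; simp
  map_mul' g h := by ext; simp [mul_assoc]

/-- A translation-invariant space of functions containing a nonconstant function carries a
nontrivial representation. -/
theorem le_finrank_of_translation_invariant {G : Type*} [Group G] [Finite G] {k : ℕ}
    (hrep : ∀ (d : ℕ) (ρ : G →* Matrix.GeneralLinearGroup (Fin d) ℂ), (∃ g, ρ g ≠ 1) → k ≤ d)
    (E : Submodule ℂ (G → ℂ)) (hE : ∀ g : G, ∀ f ∈ E, (fun x => f (g⁻¹ * x)) ∈ E)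
    {f : G → ℂ} (hf : f ∈ E) {a b : G} (hab : f a ≠ f b) : k ≤ Module.finrank ℂ E := by
  let e := LinearMap.toMatrixAlgEquiv (Module.finBasis ℂ E)
  refine hrep _ ((e : Module.End ℂ E →* _).comp (translationOn E hE)).toHomUnits ⟨a * b⁻¹, ?_⟩
  intro h
  have h1 : e (translationOn E hE (a * b⁻¹)) = e 1 := by
    rw [map_one]; exact congrArg Units.val h
  have h2 := congrFun (congrArg Subtype.val (LinearMap.congr_fun (e.injective h1) ⟨f, hf⟩)) a
  simp [translationOn] at h2
  exact hab h2.symm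

open scoped ComplexOrder in
open Finset in
/-- Convolution with a function of mean zero on a quasirandom group has small operator norm: every
eigenspace of its positive semidefinite square with nonzero eigenvalue carries a nontrivial
representation, so the eigenvalue has multiplicity at least `k`. -/
theorem sum_sq_convolution_le {G : Type*} [Group G] [Fintype G] [DecidableEq G] {k : ℕ}
    (hrep : ∀ (d : ℕ) (ρ : G →* Matrix.GeneralLinearGroup (Fin d) ℂ), (∃ g, ρ g ≠ 1) → k ≤ d)
    (hk : 0 < k) (f : G → ℝ) (hf : ∑ x, f x = 0) (v : G → ℝ) :
    ∑ x, (∑ y, f (x * y) * v y) ^ 2 ≤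
      (Fintype.card G * ∑ x, f x ^ 2) / k * ∑ y, v y ^ 2 := by
  set M : Matrix G G ℂ := Matrix.of fun x y => (f (x * y) : ℂ) with hM
  set N := M.conjTranspose * M with hNdef
  have hN : N.PosSemidef := Matrix.posSemidef_conjTranspose_mul_self M
  have htr : N.trace.re = Fintype.card G * ∑ x, f x ^ 2 := by
    have : N.trace = ((∑ y, ∑ x, f (x * y) ^ 2 : ℝ) : ℂ) := by
      simp [Matrix.trace, hNdef, Matrix.mul_apply, hM, sq]
    rw [this, Complex.ofReal_re]
    have (y : G) : ∑ x, f (x * y) ^ 2 = ∑ x, f x ^ 2 :=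
      Equiv.sum_comp (Equiv.mulRight y) fun x => f x ^ 2
    simp [this]
  have hcst (a : ℂ) : N.mulVec (fun _ => a) = 0 := by
    rw [hNdef, ← Matrix.mulVec_mulVec]
    have : M.mulVec (fun _ => a) = 0 := by
      ext x
      have h0 : ∑ y, f (x * y) = 0 := by rw [← hf]; exact Equiv.sum_comp (Equiv.mulLeft x) f
      simp only [Matrix.mulVec, dotProduct, hM, Matrix.of_apply, ← Finset.sum_mul, Pi.zero_apply]
      rw [← Complex.ofReal_sum, h0]; simp
    rw [this, Matrix.mulVec_zero]
  have hinv (g y z : G) : N (g * y) (g * z) = N y z := by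
    simp only [hNdef, Matrix.mul_apply, Matrix.conjTranspose_apply, hM, Matrix.of_apply,
      ← mul_assoc]
    exact Equiv.sum_comp (Equiv.mulRight g) fun x => star (f (x * y) : ℂ) * (f (x * z) : ℂ)
  have hbound := hN.1.posSemidef_smul_one_sub (Fintype.card G * (∑ x, f x ^ 2) / k) ?_
  · have h1 := hbound.re_dotProduct_nonneg fun y => (v y : ℂ)
    have h2 : star (fun y => (v y : ℂ)) ⬝ᵥ N.mulVec (fun y => (v y : ℂ)) =
        ((∑ x, (∑ y, f (x * y) * v y) ^ 2 : ℝ) : ℂ) := by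
      rw [hNdef, ← Matrix.mulVec_mulVec, Matrix.dotProduct_mulVec, ← Matrix.star_mulVec]
      simp [dotProduct, Matrix.mulVec, hM, sq]
    have h3 : star (fun y => (v y : ℂ)) ⬝ᵥ (fun y => (v y : ℂ)) = ((∑ y, v y ^ 2 : ℝ) : ℂ) := by
      simp [dotProduct, sq]
    rw [Matrix.sub_mulVec, Matrix.smul_mulVec, Matrix.one_mulVec, dotProduct_sub,
      dotProduct_smul, h2, h3, smul_eq_mul, ← Complex.ofReal_mul, ← Complex.ofReal_sub] at h1
    simpa only [RCLike.re_to_complex, Complex.ofReal_re, sub_nonneg] using h1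
  · intro c w hw hcw
    rw [le_div_iff₀ (by positivity), ← htr, mul_comm]
    rcases le_or_gt c 0 with hc | hc
    · rw [htr]
      exact (mul_nonpos_of_nonneg_of_nonpos (by positivity) hc).trans (by positivity)
    refine le_trans ?_ (hN.finrank_eigenspace_mul_le_trace c)
    gcongr
    have hmem (u : G → ℂ) : u ∈ Module.End.eigenspace (Matrix.toLin' N) (c : ℂ) ↔ N.mulVec u = (c : ℂ) • u := by
      rw [Module.End.mem_eigenspace_iff, Matrix.toLin'_apply]
    have hne : ∃ a b, w a ≠ w b := by
      by_contra! hall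
      have hw' : w = fun _ => w 1 := funext fun a => hall a 1
      rw [hw', hcst, ← hw'] at hcw
      exact (smul_ne_zero (by exact_mod_cast hc.ne') hw) hcw.symm
    obtain ⟨a, b, hab⟩ := hne
    refine le_finrank_of_translation_invariant hrep _ (fun g u hu => ?_) ((hmem w).2 hcw) hab
    rw [hmem] at hu ⊢
    ext x
    have h1 := congrFun hu (g⁻¹ * x)
    simp only [Matrix.mulVec, dotProduct, Pi.smul_apply] at h1 ⊢
    rw [← h1, ← Equiv.sum_comp (Equiv.mulLeft g⁻¹) fun z => N (g⁻¹ * x) z * u z]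
    simp [hinv]

open Finset in
/-- In a quasirandom group, for few `x` does `{y ∈ B | x * y ∈ A}` have less than half the size
expected of it. -/
theorem card_sparse_translates_mul_le {G : Type*} [Group G] [Fintype G] [DecidableEq G] {k : ℕ}
    (hrep : ∀ (d : ℕ) (ρ : G →* Matrix.GeneralLinearGroup (Fin d) ℂ), (∃ g, ρ g ≠ 1) → k ≤ d)
    (hk : 0 < k) (A B : Finset G) :
    (#{x | 2 * (Fintype.card G : ℝ) * #{y ∈ B | x * y ∈ A} < #A * #B} : ℝ) * (k * (#A * #B)) ≤
      4 * (Fintype.card G : ℝ) ^ 3 := by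
  set n := (Fintype.card G : ℝ) with hn
  have hn0 : 0 < n := by rw [hn]; exact_mod_cast Fintype.card_pos
  set a := (#A : ℝ)
  set b := (#B : ℝ)
  have ha : 0 ≤ a := by positivity
  have hb : 0 ≤ b := by positivity
  set D : Finset G := {x | 2 * n * #{y ∈ B | x * y ∈ A} < a * b}
  let f : G → ℝ := fun x => (if x ∈ A then 1 else 0) - a / n
  let v : G → ℝ := fun y => if y ∈ B then 1 else 0
  have hf : ∑ x, f x = 0 := by
    simp [f, Finset.sum_sub_distrib, ← hn, a]; field_simp; simp
  have hf2 : ∑ x, f x ^ 2 ≤ a := by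
    have : ∑ x, f x ^ 2 = a - a ^ 2 / n := by
      calc _ = ∑ x, ((1 - 2 * (a / n)) * (if x ∈ A then 1 else 0) + (a / n) ^ 2) := by
            refine sum_congr rfl fun x _ => ?_
            simp only [f]; split_ifs <;> ring
        _ = _ := by
            rw [sum_add_distrib, ← mul_sum]; simp [← hn]
            change (1 - 2 * (a / n)) * a + n * (a / n) ^ 2 = _
            field_simp; ring
    rw [this]; have : 0 ≤ a ^ 2 / n := by positivity
    linarith
  have hv2 : ∑ y, v y ^ 2 = b := by simp [v, b]
  have hT (x : G) : ∑ y, f (x * y) * v y = #{y ∈ B | x * y ∈ A} - a * b / n := by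
    calc _ = ∑ y, ((if y ∈ B ∧ x * y ∈ A then (1 : ℝ) else 0) - a / n * v y) := by
          refine sum_congr rfl fun y _ => ?_
          simp only [f, v]; split_ifs <;> simp_all
      _ = _ := by
          have hfilter : ({y | y ∈ B ∧ x * y ∈ A} : Finset G) = {y ∈ B | x * y ∈ A} := by
            ext; simp
          rw [sum_sub_distrib, ← mul_sum, sum_boole, hfilter]
          simp [v, b]; ring
  have hmain := sum_sq_convolution_le hrep hk f hf v
  rw [hv2, ← hn] at hmain
  have hkey : (#D : ℝ) * (a * b / (2 * n)) ^ 2 ≤ n * a / k * b := by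
    calc (#D : ℝ) * (a * b / (2 * n)) ^ 2 = ∑ x ∈ D, (a * b / (2 * n)) ^ 2 := by simp
      _ ≤ ∑ x ∈ D, (∑ y, f (x * y) * v y) ^ 2 := by
        refine sum_le_sum fun x hx => ?_
        rw [hT, ← neg_sq ((_ : ℝ) - _)]
        have hx' : 2 * n * #{y ∈ B | x * y ∈ A} < a * b := (mem_filter.1 hx).2
        have : (#{y ∈ B | x * y ∈ A} : ℝ) ≤ a * b / (2 * n) := by
          rw [le_div_iff₀ (by positivity)]; linarith
        have h2 : a * b / n = 2 * (a * b / (2 * n)) := by field_simp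
        gcongr
        linarith
      _ ≤ ∑ x, (∑ y, f (x * y) * v y) ^ 2 :=
        sum_le_sum_of_subset_of_nonneg (subset_univ _) fun _ _ _ => sq_nonneg _
      _ ≤ _ := hmain.trans (by gcongr)
  have hk' : (0 : ℝ) < k := by exact_mod_cast hk
  rcases (mul_nonneg ha hb).eq_or_lt with h0 | h0
  · rw [← h0]; simp; positivity
  · refine le_of_mul_le_mul_right ?_ h0
    have := mul_le_mul_of_nonneg_right hkey (show 0 ≤ k * (2 * n) ^ 2 by positivity)
    field_simp at this
    nlinarith

open Finset in

/-- Corollary 5.5 (Gowers, Quasirandom Groups): if every nontrivial complex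
representation of a finite group `G` of order `n` has dimension at least `k`,
`m ≥ 2`, each `A_{ij} ⊆ G` (for `i < j`) has density `p`, and
`p^{2m−3} ≥ 2^{3m}/k`, then there exist `x₁, …, x_m ∈ G` with `xᵢxⱼ ∈ A_{ij}`
for every `i < j`. -/
theorem simultaneous_pair_products
    (G : Type) [Group G] [Fintype G] (k : ℕ) (hk0 : 0 < k)
    (hrep : ∀ (d : ℕ) (ρ : G →* Matrix.GeneralLinearGroup (Fin d) ℂ),
      (∃ g, ρ g ≠ 1) → k ≤ d)
    (m : ℕ) (hm : 2 ≤ m) (A : Fin m → Fin m → Finset G) (p : ℝ)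
    (hA : ∀ i j : Fin m, i < j → ((A i j).card : ℝ) = p * Fintype.card G)
    (hp : (2 : ℝ) ^ (3 * m) / (k : ℝ) ≤ p ^ (2 * m - 3)) :
    ∃ x : Fin m → G, ∀ i j : Fin m, i < j → x i * x j ∈ A i j := by
  classical
  have hk : (0 : ℝ) < k := by exact_mod_cast hk0
  have hn : (0 : ℝ) < Fintype.card G := by exact_mod_cast Fintype.card_pos
  have hp0 : 0 < p := by
    have : Odd (2 * m - 3) := ⟨m - 2, by omega⟩
    exact this.pow_pos_iff.1 (lt_of_lt_of_le (by positivity) hp)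
  have hp1 : p ≤ 1 := by
    have h := hA ⟨0, by omega⟩ ⟨1, by omega⟩ (by simp)
    have : (#(A ⟨0, by omega⟩ ⟨1, by omega⟩) : ℝ) ≤ Fintype.card G := by
      exact_mod_cast card_le_univ _
    rw [h] at this
    nlinarith
  have hlarge (t : ℕ) (ht : t + 2 ≤ m) : m * 4 ^ (t + 1) < k * p ^ (2 * t + 1) := by
    have h1 : (m : ℝ) < 2 ^ m := by exact_mod_cast Nat.lt_two_pow_self
    calc (m : ℝ) * 4 ^ (t + 1) < 2 ^ m * 4 ^ (t + 1) := by gcongr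
      _ ≤ 2 ^ m * 4 ^ m := by gcongr <;> first | omega | norm_num
      _ = 2 ^ (3 * m) := by rw [← mul_pow, pow_mul]; norm_num
      _ ≤ k * p ^ (2 * m - 3) := by rwa [div_le_iff₀' hk] at hp
      _ ≤ k * p ^ (2 * t + 1) := by
        gcongr ?_ * ?_
        exact pow_le_pow_of_le_one hp0.le hp1 (by omega)
  have hgreedy : ∀ t ≤ m, ∃ x : Fin m → G,
      (∀ i j : Fin m, i < j → (j : ℕ) < t → x i * x j ∈ A i j) ∧
      ∀ j : Fin m, t ≤ j →
        (p / 2) ^ t * Fintype.card G ≤ #{y : G | ∀ i : Fin m, (i : ℕ) < t → x i * y ∈ A i j} := by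
    intro t
    induction t with
    | zero => exact fun _ => ⟨fun _ => 1, by simp, by simp⟩
    | succ t ih =>
      intro ht
      obtain ⟨x, hx, hcard⟩ := ih (by omega)
      let s : Fin m := ⟨t, by omega⟩
      let B : Fin m → Finset G := fun j => {y | ∀ i : Fin m, (i : ℕ) < t → x i * y ∈ A i j}
      let D : Fin m → Finset G := fun j =>
        {z | 2 * (Fintype.card G : ℝ) * #{y ∈ B j | z * y ∈ A s j} < #(A s j) * #(B j)}
      have hB (j : Fin m) (hj : s ≤ j) : (p / 2) ^ t * Fintype.card G ≤ #(B j) := hcard j hj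
      have hD (j : Fin m) (hj : s < j) : (m : ℝ) * #(D j) < (p / 2) ^ t * Fintype.card G := by
        have h1 : (#(D j) : ℝ) * (k * (#(A s j) * #(B j))) ≤ 4 * (Fintype.card G : ℝ) ^ 3 :=
          card_sparse_translates_mul_le hrep hk0 (A s j) (B j)
        have h2 : (#(D j) : ℝ) * (k * (p * Fintype.card G * ((p / 2) ^ t * Fintype.card G))) ≤
            4 * (Fintype.card G : ℝ) ^ 3 := by
          refine le_trans ?_ h1
          rw [hA s j hj]
          gcongr
          exact hB j hj.le
        have h3 := hlarge t (by have := j.2; have : t < j := hj; omega)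
        have hq : (0 : ℝ) < (p / 2) ^ t := by positivity
        have h4 : (m : ℝ) * 4 < k * p * (p / 2) ^ t * (p / 2) ^ t := by
          have : k * p * (p / 2) ^ t * (p / 2) ^ t = k * p ^ (2 * t + 1) / 4 ^ t := by
            rw [mul_assoc, ← mul_pow, show p / 2 * (p / 2) = p ^ 2 / 4 by ring, div_pow, ← pow_mul]
            ring
          rw [this, lt_div_iff₀ (by positivity)]
          calc _ = (m : ℝ) * 4 ^ (t + 1) := by ring
            _ < _ := h3
        have h5 : (#(D j) : ℝ) * (k * p * (p / 2) ^ t) ≤ 4 * Fintype.card G := by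
          refine le_of_mul_le_mul_right ?_ (pow_pos hn 2)
          calc _ = _ := by ring
            _ ≤ _ := h2
            _ = _ := by ring
        refine lt_of_mul_lt_mul_right ?_ (show 0 ≤ k * p * (p / 2) ^ t by positivity)
        calc _ = m * (#(D j) * (k * p * (p / 2) ^ t)) := by ring
          _ ≤ m * (4 * Fintype.card G) := by gcongr
          _ = m * 4 * Fintype.card G := by ring
          _ < k * p * (p / 2) ^ t * (p / 2) ^ t * Fintype.card G := by gcongr
          _ = _ := by ring
      obtain ⟨z, hzB, hzD⟩ : ∃ z ∈ B s, ∀ j, s < j → z ∉ D j := by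
        have hlt : #((Ioi s).biUnion D) < #(B s) := by
          have hm0 : (0 : ℝ) < m := by exact_mod_cast (by omega : 0 < m)
          have hq : 0 < (p / 2) ^ t * Fintype.card G := by positivity
          have h1 : (m : ℝ) * #((Ioi s).biUnion D) < m * ((p / 2) ^ t * Fintype.card G) := by
            rcases (Ioi s).eq_empty_or_nonempty with he | he
            · rw [he]; simp; positivity
            calc (m : ℝ) * #((Ioi s).biUnion D) ≤ m * ∑ j ∈ Ioi s, (#(D j) : ℝ) := by
                  gcongr; exact_mod_cast card_biUnion_le
              _ = ∑ j ∈ Ioi s, (m : ℝ) * #(D j) := mul_sum _ _ _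
              _ < ∑ j ∈ Ioi s, (p / 2) ^ t * Fintype.card G :=
                sum_lt_sum_of_nonempty he fun j hj => hD j (mem_Ioi.1 hj)
              _ = #(Ioi s) * ((p / 2) ^ t * Fintype.card G) := by simp
              _ ≤ _ := by
                gcongr
                simpa using card_le_univ (Ioi s)
          exact_mod_cast (lt_of_mul_lt_mul_left h1 hm0.le).trans_le (hB s le_rfl)
        obtain ⟨z, hz, hz'⟩ := exists_mem_notMem_of_card_lt_card hlt
        exact ⟨z, hz, fun j hj hjD => hz' (mem_biUnion.2 ⟨j, mem_Ioi.2 hj, hjD⟩)⟩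
      have hupd (i : Fin m) (hi : (i : ℕ) < t) : Function.update x s z i = x i :=
        Function.update_of_ne (fun h => by simp [h, s] at hi) _ _
      refine ⟨Function.update x s z, fun i j hij hj => ?_, fun j hj => ?_⟩
      · rcases Nat.lt_succ_iff_lt_or_eq.1 hj with hj | hj
        · rw [hupd i (lt_trans hij hj), hupd j hj]
          exact hx i j hij hj
        · obtain rfl : j = s := Fin.ext hj
          rw [hupd i hij, Function.update_self]
          exact (mem_filter.1 hzB).2 i hij
      · have hsj : s < j := hj
        have h1 : #(A s j) * #(B j) ≤ 2 * (Fintype.card G : ℝ) * #{y ∈ B j | z * y ∈ A s j} := by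
          simpa [D] using hzD j hsj
        have h2 : ({y ∈ B j | z * y ∈ A s j} : Finset G) ⊆
            ({y | ∀ i : Fin m, (i : ℕ) < t + 1 → Function.update x s z i * y ∈ A i j} : Finset G) := by
          intro y hy
          obtain ⟨hyB, hyA⟩ := mem_filter.1 hy
          refine mem_filter.2 ⟨mem_univ _, fun i hi => ?_⟩
          rcases Nat.lt_succ_iff_lt_or_eq.1 hi with hi | hi
          · rw [hupd i hi]
            exact (mem_filter.1 hyB).2 i hi
          · obtain rfl : i = s := Fin.ext hi
            rwa [Function.update_self]
        refine le_trans ?_ (Nat.cast_le.2 (card_le_card h2))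
        rw [hA s j hsj] at h1
        refine le_of_mul_le_mul_left ?_ (show 0 < 2 * (Fintype.card G : ℝ) by positivity)
        refine le_trans ?_ h1
        calc _ = p * Fintype.card G * ((p / 2) ^ t * Fintype.card G) := by ring
          _ ≤ _ := by gcongr; exact hB j hsj.le
  obtain ⟨x, hx, -⟩ := hgreedy m le_rfl
  exact ⟨x, fun i j hij => hx i j hij j.2⟩
end
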